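/- Let L be a 3-dimensional subspace of the quadratic forms in k[x₀,x₁,x₂,x₃] containing no nonzero quadratic form of rank at most 2 (so that the projection of the second Veronese of P³ from P(L) is a regular embedding into P⁶). Then the following are equivalent: (i) K(L) ≠ 0, i.e. some nonzero cubic vanishes on the projected image X_L; (ii) dim_k K(L) ≥ 3, i.e. X_L is contained in an at least three-dimensional space of cubic hypersurfaces; (iii) L is spanned by partial derivatives of a cubic form, i.e. there exist a homogeneous cubic F ∈ k[x₀,x₁,x₂,x₃] and vectors v₁,v₂,v₃ ∈ k⁴ with L = span_k(D_{v₁}F, D_{v₂}F, D_{v₃}F). -/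

import Mathlib

open MvPolynomial

noncomputable section

variable {k : Type} [Field k]

/-- The constant-coefficient differential operator `∂^m` on `k[x₀,x₁,x₂,x₃]`
associated to a monomial exponent vector `m`. -/
noncomputable def monD (k : Type) [Field k] (m : Fin 4 →₀ ℕ) :
    Module.End k (MvPolynomial (Fin 4) k) :=
  ((pderiv (0 : Fin 4)).toLinearMap) ^ (m 0) * ((pderiv 1).toLinearMap) ^ (m 1) *
    ((pderiv 2).toLinearMap) ^ (m 2) * ((pderiv 3).toLinearMap) ^ (m 3)

/-- The apolarity action `f(∂)(g)` of a polynomial `f` (viewed as a constant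
coefficient differential operator) on a polynomial `g`. -/
noncomputable def diffOp (f g : MvPolynomial (Fin 4) k) : MvPolynomial (Fin 4) k :=
  ∑ m ∈ f.support, (coeff m f) • (monD k m g)

/-- The apolar perpendicular of a space `L` of quadratic forms: all quadratic
forms `q` with `⟨q, f⟩ = q(∂)(f) = 0` for all `f ∈ L`. -/
def perpSet (L : Submodule k (MvPolynomial (Fin 4) k)) : Set (MvPolynomial (Fin 4) k) :=
  {q | q.IsHomogeneous 2 ∧ ∀ f ∈ L, diffOp q f = 0}

/-- `q : Fin 7 → k[x]₂` is a basis of `L^⊥`. -/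
def IsPerpBasis (L : Submodule k (MvPolynomial (Fin 4) k))
    (q : Fin 7 → MvPolynomial (Fin 4) k) : Prop :=
  LinearIndependent k q ∧
    (Submodule.span k (Set.range q) : Set (MvPolynomial (Fin 4) k)) = perpSet L

/-- `K(L)`: the space of homogeneous cubics `C ∈ k[y₀,…,y₆]` with `C(q₀,…,q₆) = 0`,
for a basis `q₀,…,q₆` of `L^⊥`; i.e. cubic hypersurfaces through the projected
Veronese `X_L`. -/
noncomputable def cubicRelations (q : Fin 7 → MvPolynomial (Fin 4) k) :
    Submodule k (MvPolynomial (Fin 7) k) :=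
  (homogeneousSubmodule (Fin 7) k 3) ⊓ LinearMap.ker (aeval q).toLinearMap

/-- The symmetric Gram matrix of a quadratic form (characteristic ≠ 2). -/
def gram (q : MvPolynomial (Fin 4) k) : Matrix (Fin 4) (Fin 4) k :=
  Matrix.of fun i j =>
    if i = j then coeff (Finsupp.single i 2) q
    else coeff (Finsupp.single i 1 + Finsupp.single j 1) q / 2

/-- The directional derivative `D_v = Σᵢ vᵢ ∂/∂xᵢ`. -/
noncomputable def dirDeriv (v : Fin 4 → k) (F : MvPolynomial (Fin 4) k) :
    MvPolynomial (Fin 4) k :=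
  ∑ i, v i • pderiv i F


section partPB
lemma pencil_lemma [IsAlgClosed k] {P P' : Type} [AddCommGroup P] [Module k P] [AddCommGroup P']
    [Module k P'] [FiniteDimensional k P] [FiniteDimensional k P'] [Nontrivial P]
    (hfr : Module.finrank k P = Module.finrank k P') (f g : P →ₗ[k] P') :
    ∃ (α β : k) (v : P), (α ≠ 0 ∨ β ≠ 0) ∧ v ≠ 0 ∧ α • f v + β • g v = 0 := by
  by_cases hf : Function.Injective f
  · let e := LinearEquiv.ofInjectiveOfFinrankEq f hf hfr
    obtain ⟨μ, hμ⟩ := Module.End.exists_eigenvalue (e.symm.toLinearMap ∘ₗ g)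
    obtain ⟨v, hv⟩ := hμ.exists_hasEigenvector
    refine ⟨-μ, 1, v, Or.inr one_ne_zero, hv.2, ?_⟩
    have h1 := hv.apply_eq_smul
    have h2 : g v = e (μ • v) := by
      rw [← h1]; simp
    have h3 : e v = f v := rfl
    rw [h2, map_smul, h3]
    simp
  · rw [← LinearMap.ker_eq_bot, Submodule.eq_bot_iff] at hf
    push Not at hf
    obtain ⟨v, hv, hv0⟩ := hf
    refine ⟨1, 0, v, Or.inl one_ne_zero, hv0, ?_⟩
    simp [LinearMap.mem_ker.1 hv]

lemma pencil_rel [IsAlgClosed k] {M M' : Type} [AddCommGroup M] [Module k M] [AddCommGroup M']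
    [Module k M'] (Z B : Submodule k M) (Z' B' : Submodule k M')
    [FiniteDimensional k Z] [FiniteDimensional k Z'] (f g : M →ₗ[k] M')
    (hfZ : ∀ z ∈ Z, f z ∈ Z') (hgZ : ∀ z ∈ Z, g z ∈ Z')
    (hfB : ∀ z ∈ B, f z ∈ B') (hgB : ∀ z ∈ B, g z ∈ B')
    (hinj : ∀ α β : k, (α ≠ 0 ∨ β ≠ 0) → ∀ z ∈ Z, α • f z + β • g z ∈ B' → z ∈ B)
    (hsurj : ∀ z' ∈ Z', ∃ z ∈ Z, z' - f z ∈ B') : Z ≤ B := by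
  have hf0 : B.comap Z.subtype ≤ (B'.comap Z'.subtype).comap (f.restrict hfZ) := by
    intro z hz; exact hfB _ hz
  have hg0 : B.comap Z.subtype ≤ (B'.comap Z'.subtype).comap (g.restrict hgZ) := by
    intro z hz; exact hgB _ hz
  let f1 : (Z ⧸ B.comap Z.subtype) →ₗ[k] (Z' ⧸ B'.comap Z'.subtype) :=
    Submodule.mapQ _ _ (f.restrict hfZ) hf0
  let g1 : (Z ⧸ B.comap Z.subtype) →ₗ[k] (Z' ⧸ B'.comap Z'.subtype) :=
    Submodule.mapQ _ _ (g.restrict hgZ) hg0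
  have key : ∀ α β : k, (α ≠ 0 ∨ β ≠ 0) → ∀ v, α • f1 v + β • g1 v = 0 → v = 0 := by
    intro α β hab v hv
    obtain ⟨z, rfl⟩ := Submodule.Quotient.mk_surjective _ v
    rw [Submodule.Quotient.mk_eq_zero]
    refine hinj α β hab z z.2 ?_
    simp only [f1, g1, Submodule.mapQ_apply, ← Submodule.Quotient.mk_smul,
      ← Submodule.Quotient.mk_add, Submodule.Quotient.mk_eq_zero] at hv
    exact hv
  have hf1i : Function.Injective f1 := by
    rw [← LinearMap.ker_eq_bot, Submodule.eq_bot_iff]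
    intro v hv
    exact key 1 0 (Or.inl one_ne_zero) v (by simp [LinearMap.mem_ker.1 hv])
  have hf1s : Function.Surjective f1 := by
    intro v
    obtain ⟨z', rfl⟩ := Submodule.Quotient.mk_surjective _ v
    obtain ⟨z, hz, hzz⟩ := hsurj z' z'.2
    refine ⟨Submodule.Quotient.mk ⟨z, hz⟩, ?_⟩
    symm
    simp only [f1, Submodule.mapQ_apply]
    rw [Submodule.Quotient.eq]
    exact hzz
  have hfr := LinearEquiv.finrank_eq (LinearEquiv.ofBijective f1 ⟨hf1i, hf1s⟩)
  by_contra hcon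
  have hnt : Nontrivial (Z ⧸ B.comap Z.subtype) := by
    rw [Submodule.Quotient.nontrivial_iff]
    intro h
    apply hcon
    intro z hz
    have : (⟨z, hz⟩ : Z) ∈ B.comap Z.subtype := by rw [h]; trivial
    exact this
  obtain ⟨α, β, v, hab, hv, h0⟩ := pencil_lemma hfr f1 g1
  exact hv (key α β hab v h0)

lemma rank_le_two_of_ker {M : Matrix (Fin 4) (Fin 4) k} {w v : Fin 4 → k}
    (hw : M.mulVec w = 0) (hv : M.mulVec v = 0) (hli : LinearIndependent k ![w, v]) :
    M.rank ≤ 2 := by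
  have h1 := LinearMap.finrank_range_add_finrank_ker M.mulVecLin
  have h2 : 2 ≤ Module.finrank k (LinearMap.ker M.mulVecLin) := by
    have h3 : Submodule.span k (Set.range ![w, v]) ≤ LinearMap.ker M.mulVecLin := by
      rw [Submodule.span_le]
      rintro _ ⟨i, rfl⟩
      fin_cases i
      · exact hw
      · exact hv
    have h4 := Submodule.finrank_mono h3
    rw [finrank_span_eq_card hli] at h4
    simpa using h4
  simp at h1
  unfold Matrix.rank
  omega

lemma pencil_sym [IsAlgClosed k] {A B : Matrix (Fin 4) (Fin 4) k} (hA : A.IsSymm) (hB : B.IsSymm)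
    {w : Fin 4 → k} (hw : w ≠ 0) (hAw : A.mulVec w = 0) (hBw : B.mulVec w = 0) :
    ∃ α β : k, (α ≠ 0 ∨ β ≠ 0) ∧ (α • A + β • B).rank ≤ 2 := by
  let φ : (Fin 4 → k) →ₗ[k] k := dotProductBilin k k w
  have hφ : ∀ v, φ v = w ⬝ᵥ v := fun v => rfl
  have hφ0 : φ ≠ 0 := by
    intro h
    apply hw
    funext i
    have := congrArg (fun f => f (Pi.single i 1)) h
    simpa [hφ] using this
  have hsym : ∀ {C : Matrix (Fin 4) (Fin 4) k}, C.IsSymm → C.mulVec w = 0 → ∀ v, φ (C.mulVec v) = 0 := by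
    intro C hC hCw v
    rw [hφ, Matrix.dotProduct_mulVec, ← Matrix.mulVec_transpose, hC.eq, hCw, zero_dotProduct]
  let mk : ∀ C : Matrix (Fin 4) (Fin 4) k, C.IsSymm → C.mulVec w = 0 →
    ((Fin 4 → k) ⧸ Submodule.span k {w}) →ₗ[k] LinearMap.ker φ := fun C hC hCw =>
      Submodule.liftQ _ (C.mulVecLin.codRestrict (LinearMap.ker φ) (fun v => hsym hC hCw v)) (by
        rw [Submodule.span_le, Set.singleton_subset_iff]
        simp only [SetLike.mem_coe, LinearMap.mem_ker]
        exact Subtype.ext hCw)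
  have d1 : Module.finrank k ((Fin 4 → k) ⧸ Submodule.span k {w}) = 3 := by
    have := Submodule.finrank_quotient_add_finrank (Submodule.span k {w})
    rw [finrank_span_singleton hw] at this
    simp at this
    omega
  have d2 : Module.finrank k (LinearMap.ker φ) = 3 := by
    have := LinearMap.finrank_range_add_finrank_ker φ
    rw [LinearMap.range_eq_top.2 (LinearMap.surjective hφ0)] at this
    simp at this
    omega
  have : Nontrivial ((Fin 4 → k) ⧸ Submodule.span k {w}) := Module.nontrivial_of_finrank_pos (R := k) (by omega)
  obtain ⟨α, β, v, hab, hv, h0⟩ := pencil_lemma (d1.trans d2.symm) (mk A hA hAw) (mk B hB hBw)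
  obtain ⟨v, rfl⟩ := Submodule.Quotient.mk_surjective _ v
  refine ⟨α, β, hab, rank_le_two_of_ker (w := w) (v := v) ?_ ?_ ?_⟩
  · simp [Matrix.add_mulVec, Matrix.smul_mulVec, hAw, hBw]
  · have := congrArg Subtype.val h0
    rw [Matrix.add_mulVec, Matrix.smul_mulVec, Matrix.smul_mulVec]
    exact this
  · rw [LinearIndependent.pair_iff' hw]
    intro a ha
    apply hv
    rw [Submodule.Quotient.mk_eq_zero, ← ha]
    exact Submodule.smul_mem _ _ (Submodule.mem_span_singleton_self _)
end partPB

section partPC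
def Sg (k : Type) [Field k] (e : ℤ) : Submodule k (MvPolynomial (Fin 4) k) :=
  if e < 0 then ⊥ else homogeneousSubmodule (Fin 4) k e.toNat

lemma Sg_neg {e : ℤ} (he : e < 0) : Sg k e = ⊥ := by simp [Sg, he]

lemma Sg_nat (n : ℕ) : Sg k (n : ℤ) = homogeneousSubmodule (Fin 4) k n := by
  simp [Sg]

lemma Sg_mul {e f : ℤ} {p q : MvPolynomial (Fin 4) k} (hp : p ∈ Sg k e) (hq : q ∈ Sg k f) :
    p * q ∈ Sg k (e + f) := by
  rcases lt_or_ge e 0 with he | he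
  · rw [Sg_neg he, Submodule.mem_bot] at hp
    simp [hp]
  rcases lt_or_ge f 0 with hf | hf
  · rw [Sg_neg hf, Submodule.mem_bot] at hq
    simp [hq]
  obtain ⟨m, rfl⟩ := Int.eq_ofNat_of_zero_le he
  obtain ⟨n, rfl⟩ := Int.eq_ofNat_of_zero_le hf
  rw [Sg_nat] at hp hq
  have : ((m : ℤ) + (n : ℤ)) = ((m + n : ℕ) : ℤ) := by push_cast; rfl
  rw [this, Sg_nat]
  exact IsHomogeneous.mul hp hq

instance Sg_fd (e : ℤ) : FiniteDimensional k (Sg k e) := by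
  rcases lt_or_ge e 0 with he | he
  · rw [Sg_neg he]; infer_instance
  · obtain ⟨m, rfl⟩ := Int.eq_ofNat_of_zero_le he
    rw [Sg_nat]
    exact Module.Finite.iff_fg.2 (homogeneousSubmodule_fg _ _ m)

/-- linear form attached to a functional -/
def lf : Module.Dual k (Fin 4 → k) →ₗ[k] MvPolynomial (Fin 4) k where
  toFun φ := ∑ i, C (φ (Pi.single i 1)) * X i
  map_add' a b := by simp [add_mul, Finset.sum_add_distrib]
  map_smul' a b := by simp [Finset.smul_sum, smul_eq_C_mul, mul_assoc]

lemma lf_apply (φ : Module.Dual k (Fin 4 → k)) : lf φ = ∑ i, C (φ (Pi.single i 1)) * X i := rfl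

lemma eval_lf (φ : Module.Dual k (Fin 4 → k)) (v : Fin 4 → k) : eval v (lf φ) = φ v := by
  conv_rhs => rw [LinearMap.pi_apply_eq_sum_univ φ v]
  rw [lf_apply, map_sum]
  refine Finset.sum_congr rfl fun i _ => ?_
  have : (fun j => if i = j then (1 : k) else 0) = Pi.single i 1 := by
    funext j; simp [Pi.single_apply, eq_comm]
  simp [this, mul_comm]

lemma lf_homog (φ : Module.Dual k (Fin 4 → k)) : (lf φ).IsHomogeneous 1 := by
  rw [lf_apply]
  exact IsHomogeneous.sum _ _ _ fun i _ => (isHomogeneous_X k i).C_mul _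

lemma lf_mem (φ : Module.Dual k (Fin 4 → k)) : lf φ ∈ Sg k 1 := by
  have := Sg_nat (k := k) 1
  rw [Nat.cast_one] at this
  rw [this]
  exact lf_homog φ

/-- ideal of polynomials vanishing on `X` -/
def Van (W : Submodule k (Fin 4 → k)) : Ideal (MvPolynomial (Fin 4) k) where
  carrier := {f | ∀ v ∈ W, eval v f = 0}
  add_mem' ha hb v hv := by rw [map_add, ha v hv, hb v hv, add_zero]
  zero_mem' v hv := map_zero _
  smul_mem' c f hf v hv := by rw [smul_eq_mul, map_mul, hf v hv, mul_zero]

lemma mem_Van {W : Submodule k (Fin 4 → k)} {f : MvPolynomial (Fin 4) k} :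
    f ∈ Van W ↔ ∀ v ∈ W, eval v f = 0 := Iff.rfl

lemma Van_mono {W W' : Submodule k (Fin 4 → k)} (h : W ≤ W') : Van W' ≤ Van W :=
  fun _ hf v hv => hf v (h hv)

lemma Van_cancel [Infinite k] {W : Submodule k (Fin 4 → k)} {φ : Module.Dual k (Fin 4 → k)}
    (hφ : ¬ W ≤ LinearMap.ker φ) {f : MvPolynomial (Fin 4) k} (hf : lf φ * f ∈ Van W) :
    f ∈ Van W := by
  intro v hv
  rw [SetLike.not_le_iff_exists] at hφ
  obtain ⟨v0, hv0, h0⟩ := hφ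
  let g : Polynomial k := aeval (fun i => Polynomial.C (v i) + Polynomial.X * Polynomial.C (v0 i)) f
  have hg : ∀ t, g.eval t = eval (v + t • v0) f := by
    intro t
    simp only [g]
    rw [← Polynomial.coe_evalRingHom, aeval_def, ← coe_eval₂Hom, ← RingHom.comp_apply]
    have : ((Polynomial.evalRingHom t).comp (eval₂Hom (algebraMap k (Polynomial k))
       (fun i => Polynomial.C (v i) + Polynomial.X * Polynomial.C (v0 i)))) = eval (v + t • v0) := by
      apply MvPolynomial.ringHom_ext
      · intro r; simp
      · intro i; simp; ring
    rw [this]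
  have hm : (Polynomial.C (φ v) + Polynomial.X * Polynomial.C (φ v0)) * g = 0 := by
    apply Polynomial.funext
    intro t
    have := hf (v + t • v0) (W.add_mem hv (W.smul_mem t hv0))
    rw [map_mul, eval_lf] at this
    rw [Polynomial.eval_mul, hg]
    rw [map_add, map_smul, smul_eq_mul] at this
    simpa [mul_comm t] using this
  rcases mul_eq_zero.1 hm with h | h
  · exfalso
    apply h0
    have := congrArg (fun p => Polynomial.coeff p 1) h
    simpa [Polynomial.coeff_C] using this
  · have := hg 0
    rw [h] at this
    simpa using this.symm

lemma Van_divide {W : Submodule k (Fin 4 → k)} {φ : Module.Dual k (Fin 4 → k)}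
    (hφ : ¬ W ≤ LinearMap.ker φ) {e : ℤ} {f : MvPolynomial (Fin 4) k} (hf : f ∈ Sg k e)
    (hv : f ∈ Van (W ⊓ LinearMap.ker φ)) : ∃ z ∈ Sg k (e - 1), f - lf φ * z ∈ Van W := by
  rcases lt_or_ge e 0 with he | he
  · rw [Sg_neg he, Submodule.mem_bot] at hf
    exact ⟨0, Submodule.zero_mem _, by simp [hf]⟩
  obtain ⟨n, rfl⟩ := Int.eq_ofNat_of_zero_le he
  rw [Sg_nat] at hf
  have hf1 : f.IsHomogeneous n := hf
  rw [SetLike.not_le_iff_exists] at hφ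
  obtain ⟨v1, hv1, h1⟩ := hφ
  rw [LinearMap.mem_ker] at h1
  let v0 := (φ v1)⁻¹ • v1
  have hv0 : v0 ∈ W := W.smul_mem _ hv1
  have h0 : φ v0 = 1 := by simp [v0, h1]
  let p : Fin 4 → MvPolynomial (Fin 4) k := fun i => X i - C (v0 i) * lf φ
  have hp : ∀ i, (p i).IsHomogeneous 1 := fun i =>
    (isHomogeneous_X k i).sub ((lf_homog φ).C_mul _)
  have hf' : (aeval p f).IsHomogeneous n := by simpa using hf1.aeval p hp
  have hvan : aeval p f ∈ Van W := by
    intro v hvW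
    have : eval v (aeval p f) = eval (v - φ v • v0) f := by
      rw [aeval_def, ← coe_eval₂Hom, ← RingHom.comp_apply]
      congr 1
      apply MvPolynomial.ringHom_ext
      · intro r; simp
      · intro i; simp [p, eval_lf, mul_comm]
    rw [this]
    apply hv
    refine ⟨W.sub_mem hvW (W.smul_mem _ hv0), ?_⟩
    simp [h0]
  have hdvd : lf φ ∣ f - aeval p f := by
    rw [← Ideal.mem_span_singleton, ← Ideal.Quotient.eq]
    let I := Ideal.span {lf φ}
    have h : (Ideal.Quotient.mkₐ k I) = (Ideal.Quotient.mkₐ k I).comp (aeval p) := by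
      apply MvPolynomial.algHom_ext
      intro i
      rw [AlgHom.comp_apply, aeval_X]
      simp only [Ideal.Quotient.mkₐ_eq_mk]
      rw [Ideal.Quotient.eq]
      simp only [p, sub_sub_cancel]
      exact I.mul_mem_left _ (Ideal.mem_span_singleton_self _)
    exact congrArg (fun g => g f) h
  obtain ⟨z0, hz0⟩ := hdvd
  have hd : (f - aeval p f).IsHomogeneous n := hf1.sub hf'
  let _ : GradedAlgebra (homogeneousSubmodule (Fin 4) k) := MvPolynomial.gradedAlgebra
  have hdec := DirectSum.coe_decompose_mul_of_left_mem (homogeneousSubmodule (Fin 4) k) (i := 1)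
    (b := z0) n (lf_homog φ)
  rw [← hz0, DirectSum.decompose_of_mem_same _ hd] at hdec
  by_cases hn : 1 ≤ n
  · rw [if_pos hn] at hdec
    refine ⟨(DirectSum.decompose (homogeneousSubmodule (Fin 4) k) z0 (n - 1) :
      MvPolynomial (Fin 4) k), ?_, ?_⟩
    rotate_left
    · rw [← sub_sub_cancel f (aeval p f), hdec] at hvan
      exact hvan
    · have : ((n : ℤ) - 1) = ((n - 1 : ℕ) : ℤ) := by omega
      rw [this, Sg_nat]
      exact Subtype.coe_prop _
  · rw [if_neg hn] at hdec
    refine ⟨0, Submodule.zero_mem _, ?_⟩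
    rw [← sub_sub_cancel f (aeval p f), hdec] at hvan
    simpa using hvan
end partPC

section partPC2
set_option linter.unusedSectionVars false

section cx
variable {ι : Type} [Fintype ι]

def Fc (k : Type) [Field k] (h : ι → ℕ) (τ : ι → ℕ) (i : ℕ) (d : ℤ) :
    Submodule k (ι → MvPolynomial (Fin 4) k) :=
  Submodule.pi Set.univ (fun a => if h a = i then Sg k (d + τ a) else ⊥)

lemma mem_Fc {h : ι → ℕ} {τ : ι → ℕ} {i : ℕ} {d : ℤ} {z : ι → MvPolynomial (Fin 4) k} :
    z ∈ Fc k h τ i d ↔ ∀ a, (h a = i → z a ∈ Sg k (d + τ a)) ∧ (h a ≠ i → z a = 0) := by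
  simp only [Fc, Submodule.mem_pi, Set.mem_univ, true_imp_iff]
  refine forall_congr' fun a => ?_
  by_cases ha : h a = i <;> simp [ha]

instance Fc_fd (h : ι → ℕ) (τ : ι → ℕ) (i : ℕ) (d : ℤ) : FiniteDimensional k (Fc k h τ i d) := by
  have : ∀ a, FiniteDimensional k
      ((if h a = i then Sg k (d + τ a) else ⊥ : Submodule k (MvPolynomial (Fin 4) k))) := by
    intro a
    by_cases ha : h a = i
    · rw [if_pos ha]; infer_instance
    · rw [if_neg ha]; infer_instance
  let f : Fc k h τ i d →ₗ[k] (∀ a, (if h a = i then Sg k (d + τ a) else ⊥ :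
      Submodule k (MvPolynomial (Fin 4) k))) :=
    { toFun := fun z a => ⟨z.1 a, z.2 a trivial⟩
      map_add' := fun _ _ => rfl
      map_smul' := fun _ _ => rfl }
  refine Module.Finite.of_injective f ?_
  intro z w hzw
  ext1
  funext a
  exact congrArg (fun g => ((g a : _) : MvPolynomial (Fin 4) k)) hzw

/-- graded complex of free modules in matrix form -/
structure IsCx (h τ : ι → ℕ) (D : Matrix ι ι (MvPolynomial (Fin 4) k)) : Prop where
  deg : ∀ a b, D a b ∈ Sg k ((τ a : ℤ) - τ b)
  supp : ∀ a b, h b ≠ h a + 1 → D a b = 0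
  sq : D * D = 0

variable {h τ : ι → ℕ} {D : Matrix ι ι (MvPolynomial (Fin 4) k)}

lemma IsCx.mulVec_mem (hD : IsCx h τ D) {i : ℕ} {d : ℤ} {w : ι → MvPolynomial (Fin 4) k}
    (hw : w ∈ Fc k h τ (i + 1) d) : D.mulVec w ∈ Fc k h τ i d := by
  rw [mem_Fc] at hw ⊢
  intro a
  constructor
  · intro ha
    refine Submodule.sum_mem _ fun b _ => ?_
    by_cases hb : h b = i + 1
    · have := Sg_mul (hD.deg a b) ((hw b).1 hb)
      convert this using 2
      ring
    · rw [(hw b).2 hb, mul_zero]; exact Submodule.zero_mem _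
  · intro ha
    refine Finset.sum_eq_zero fun b _ => ?_
    by_cases hb : h b = i + 1
    · simp only [hD.supp a b (by omega), zero_mul]
    · rw [(hw b).2 hb, mul_zero]

/-- exactness statement on the subspace `W` -/
def EX (h τ : ι → ℕ) (D : Matrix ι ι (MvPolynomial (Fin 4) k)) (i : ℕ)
    (W : Submodule k (Fin 4 → k)) (d : ℤ) : Prop :=
  ∀ z ∈ Fc k h τ i d, (∀ a, D.mulVec z a ∈ Van W) →
    ∃ w ∈ Fc k h τ (i + 1) d, ∀ a, z a - D.mulVec w a ∈ Van W

lemma mulVec_Van (W : Submodule k (Fin 4 → k)) {z : ι → MvPolynomial (Fin 4) k}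
    (hz : ∀ a, z a ∈ Van W) (a : ι) : D.mulVec z a ∈ Van W :=
  Ideal.sum_mem _ fun b _ => Ideal.mul_mem_left _ _ (hz b)

lemma Fc_divide {W : Submodule k (Fin 4 → k)} {φ : Module.Dual k (Fin 4 → k)}
    (hφ : ¬ W ≤ LinearMap.ker φ) {i : ℕ} {d : ℤ} {z : ι → MvPolynomial (Fin 4) k}
    (hz : z ∈ Fc k h τ i d) (hv : ∀ a, z a ∈ Van (W ⊓ LinearMap.ker φ)) :
    ∃ z' ∈ Fc k h τ i (d - 1), ∀ a, z a - lf φ * z' a ∈ Van W := by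
  rw [mem_Fc] at hz
  have : ∀ a, ∃ y, ((h a = i → y ∈ Sg k ((d - 1) + τ a)) ∧ (h a ≠ i → y = 0)) ∧
      z a - lf φ * y ∈ Van W := by
    intro a
    by_cases ha : h a = i
    · obtain ⟨y, hy, hy'⟩ := Van_divide hφ ((hz a).1 ha) (hv a)
      refine ⟨y, ⟨fun _ => ?_, fun h => absurd ha h⟩, hy'⟩
      convert hy using 2
      ring
    · refine ⟨0, ⟨fun h => absurd h ha, fun _ => rfl⟩, ?_⟩
      rw [(hz a).2 ha]; simp
  choose z' h1 h2 using this
  exact ⟨z', mem_Fc.2 h1, h2⟩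

lemma lf_mul_Fc (φ : Module.Dual k (Fin 4 → k)) {i : ℕ} {d : ℤ} {z : ι → MvPolynomial (Fin 4) k}
    (hz : z ∈ Fc k h τ i (d - 1)) : lf φ • z ∈ Fc k h τ i d := by
  rw [mem_Fc] at hz ⊢
  intro a
  constructor
  · intro ha
    have := Sg_mul (lf_mem φ) ((hz a).1 ha)
    simp only [Pi.smul_apply, smul_eq_mul]
    convert this using 2
    ring
  · intro ha
    simp [(hz a).2 ha]

lemma EX_step [IsAlgClosed k] (hD : IsCx h τ D) {i : ℕ} {W : Submodule k (Fin 4 → k)} {d : ℤ}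
    (hW : 2 ≤ Module.finrank k W)
    (hE : ∀ φ : Module.Dual k (Fin 4 → k), ¬ W ≤ LinearMap.ker φ →
      EX h τ D i (W ⊓ LinearMap.ker φ) d ∧ EX h τ D (i + 1) (W ⊓ LinearMap.ker φ) d) :
    EX h τ D i W (d - 1) := by
  have : Infinite k := IsAlgClosed.instInfinite
  -- two independent functionals on W
  obtain ⟨φ, ψ, hφψ⟩ : ∃ φ ψ : Module.Dual k (Fin 4 → k), ∀ α β : k, (α ≠ 0 ∨ β ≠ 0) →
      ¬ W ≤ LinearMap.ker (α • φ + β • ψ) := by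
    let r : Module.Dual k (Fin 4 → k) →ₗ[k] Module.Dual k W := W.subtype.dualMap
    have hr : Function.Surjective r := LinearMap.dualMap_surjective_of_injective W.subtype_injective
    have h2 : (Module.finrank k (Module.Dual k W)) = Module.finrank k W := Subspace.dual_finrank_eq
    obtain ⟨f, hf⟩ := exists_linearIndependent_of_le_finrank (R := k) (M := Module.Dual k W) (hW.trans h2.ge)
    obtain ⟨φ, hφ⟩ := hr (f 0)
    obtain ⟨ψ, hψ⟩ := hr (f 1)
    refine ⟨φ, ψ, fun α β hab hle => ?_⟩
    have h0 : α • f 0 + β • f 1 = 0 := by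
      rw [← hφ, ← hψ, ← map_smul, ← map_smul, ← map_add]
      ext v
      exact hle v.2
    rw [Fintype.linearIndependent_iff] at hf
    have h3 := hf ![α, β] (by simpa [Fin.sum_univ_two] using h0)
    have h4 := h3 0
    have h5 := h3 1
    simp at h4 h5
    rcases hab with h | h
    · exact h h4
    · exact h h5
  let Z : ℤ → Submodule k (ι → MvPolynomial (Fin 4) k) := fun d =>
    { carrier := {z | z ∈ Fc k h τ i d ∧ ∀ a, D.mulVec z a ∈ Van W}
      add_mem' := fun ha hb => ⟨Submodule.add_mem _ ha.1 hb.1, fun a => by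
        rw [Matrix.mulVec_add]; exact Ideal.add_mem _ (ha.2 a) (hb.2 a)⟩
      zero_mem' := ⟨Submodule.zero_mem _, fun a => by simp⟩
      smul_mem' := fun c z hz => ⟨Submodule.smul_mem _ _ hz.1, fun a => by
        rw [Matrix.mulVec_smul, Pi.smul_apply, smul_eq_C_mul]
        exact Ideal.mul_mem_left _ _ (hz.2 a)⟩ }
  let B : ℤ → Submodule k (ι → MvPolynomial (Fin 4) k) := fun d =>
    { carrier := {z | ∃ w ∈ Fc k h τ (i + 1) d, ∀ a, z a - D.mulVec w a ∈ Van W}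
      add_mem' := by
        rintro x y ⟨w, hw, hw'⟩ ⟨v, hv, hv'⟩
        refine ⟨w + v, Submodule.add_mem _ hw hv, fun a => ?_⟩
        rw [Matrix.mulVec_add, Pi.add_apply, Pi.add_apply, add_sub_add_comm]
        exact Ideal.add_mem _ (hw' a) (hv' a)
      zero_mem' := ⟨0, Submodule.zero_mem _, fun a => by simp⟩
      smul_mem' := by
        rintro c x ⟨w, hw, hw'⟩
        refine ⟨c • w, Submodule.smul_mem _ _ hw, fun a => ?_⟩
        rw [Matrix.mulVec_smul, Pi.smul_apply, Pi.smul_apply, ← smul_sub, smul_eq_C_mul]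
        exact Ideal.mul_mem_left _ _ (hw' a) }
  have hZfd : ∀ d, FiniteDimensional k (Z d) := fun d =>
    Submodule.finiteDimensional_of_le (S₂ := Fc k h τ i d) (fun z hz => hz.1)
  let mul : Module.Dual k (Fin 4 → k) → ((ι → MvPolynomial (Fin 4) k) →ₗ[k] (ι → MvPolynomial (Fin 4) k)) :=
    fun φ => (lf φ • (LinearMap.id : (ι → MvPolynomial (Fin 4) k) →ₗ[MvPolynomial (Fin 4) k] _)).restrictScalars k
  have hmul : ∀ φ z, mul φ z = lf φ • z := fun _ _ => rfl
  have hmulZ : ∀ φ, ∀ z ∈ Z (d - 1), mul φ z ∈ Z d := by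
    intro φ z hz
    refine ⟨lf_mul_Fc φ hz.1, fun a => ?_⟩
    rw [hmul, Matrix.mulVec_smul]
    exact Ideal.mul_mem_left _ _ (hz.2 a)
  have hmulB : ∀ φ, ∀ z ∈ B (d - 1), mul φ z ∈ B d := by
    rintro φ z ⟨w, hw, hw'⟩
    refine ⟨lf φ • w, lf_mul_Fc φ hw, fun a => ?_⟩
    rw [hmul, Matrix.mulVec_smul, Pi.smul_apply, Pi.smul_apply, ← smul_sub]
    exact Ideal.mul_mem_left _ _ (hw' a)
  have hsurj : ∀ φ : Module.Dual k (Fin 4 → k), ¬ W ≤ LinearMap.ker φ →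
      ∀ z ∈ Z d, ∃ y ∈ Z (d - 1), z - mul φ y ∈ B d := by
    intro φ hφ z hz
    obtain ⟨w, hw, hw'⟩ := (hE φ hφ).1 z hz.1 (fun a => Van_mono inf_le_left (hz.2 a))
    obtain ⟨y, hy, hy'⟩ := Fc_divide hφ (Submodule.sub_mem _ hz.1 (hD.mulVec_mem hw)) hw'
    refine ⟨y, ⟨hy, fun a => ?_⟩, ?_⟩
    · apply Van_cancel hφ
      have h1 := mulVec_Van (D := D) W hy' a
      have h2 : (fun a => (z - D.mulVec w) a - lf φ * y a) = z - D.mulVec w - lf φ • y := rfl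
      rw [h2, Matrix.mulVec_sub, Matrix.mulVec_sub, Matrix.mulVec_mulVec, hD.sq,
        Matrix.zero_mulVec, sub_zero, Matrix.mulVec_smul, Pi.sub_apply] at h1
      have := Ideal.sub_mem _ (hz.2 a) h1
      simpa using this
    · refine ⟨w, hw, fun a => ?_⟩
      have := hy' a
      rw [hmul]
      convert this using 1
      simp only [Pi.sub_apply, Pi.smul_apply, smul_eq_mul]
      ring
  have hinj : ∀ φ : Module.Dual k (Fin 4 → k), ¬ W ≤ LinearMap.ker φ →
      ∀ z ∈ Z (d - 1), mul φ z ∈ B d → z ∈ B (d - 1) := by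
    rintro φ hφ z hz ⟨w, hw, hw'⟩
    rw [hmul] at hw'
    have h1 : ∀ a, D.mulVec w a ∈ Van (W ⊓ LinearMap.ker φ) := by
      intro a v hv
      have := hw' a v hv.1
      rw [map_sub, Pi.smul_apply, smul_eq_mul, map_mul, eval_lf, LinearMap.mem_ker.1 hv.2] at this
      simpa using this
    obtain ⟨w', hw1, hw2⟩ := (hE φ hφ).2 w hw h1
    obtain ⟨y, hy, hy'⟩ := Fc_divide hφ (Submodule.sub_mem _ hw (hD.mulVec_mem hw1)) hw2
    refine ⟨y, hy, fun a => ?_⟩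
    apply Van_cancel hφ
    have h3 := mulVec_Van (D := D) W hy' a
    have h2 : (fun a => (w - D.mulVec w') a - lf φ * y a) = w - D.mulVec w' - lf φ • y := rfl
    rw [h2, Matrix.mulVec_sub, Matrix.mulVec_sub, Matrix.mulVec_mulVec, hD.sq,
      Matrix.zero_mulVec, sub_zero, Matrix.mulVec_smul, Pi.sub_apply] at h3
    have := Ideal.add_mem _ (hw' a) h3
    convert this using 1
    simp only [Pi.smul_apply, smul_eq_mul]
    ring
  have hlin : ∀ (α β : k) z, α • mul φ z + β • mul ψ z = mul (α • φ + β • ψ) z := by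
    intro α β z
    simp only [hmul, map_add, map_smul]
    funext a
    simp [add_mul]
  have hfin := pencil_rel (Z (d - 1)) (B (d - 1)) (Z d) (B d) (mul φ) (mul ψ)
    (hmulZ φ) (hmulZ ψ) (hmulB φ) (hmulB ψ)
    (fun α β hab z hz hz' => hinj _ (hφψ α β hab) z hz (by rw [← hlin]; exact hz'))
    (hsurj φ (by have := hφψ 1 0 (Or.inl one_ne_zero); simpa using this))
  intro z hz hz'
  exact hfin ⟨hz, hz'⟩

/-- Fibrewise exactness at all nonzero points. -/
def FibEx (h : ι → ℕ) (D : Matrix ι ι (MvPolynomial (Fin 4) k)) (N : ℕ) : Prop :=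
  ∀ l : Fin 4 → k, l ≠ 0 → ∀ i ≤ N, ∀ ζ : ι → k, (∀ a, h a ≠ i → ζ a = 0) →
    (D.map (eval l)).mulVec ζ = 0 → ∃ ω : ι → k, (∀ a, h a ≠ i + 1 → ω a = 0) ∧
      (D.map (eval l)).mulVec ω = ζ

lemma eval_smul_Sg {n : ℤ} {p : MvPolynomial (Fin 4) k} (hp : p ∈ Sg k n) (t : k) (l : Fin 4 → k) :
    eval (t • l) p = t ^ n.toNat * eval l p := by
  rcases lt_or_ge n 0 with he | he
  · rw [Sg_neg he, Submodule.mem_bot] at hp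
    simp [hp]
  obtain ⟨m, rfl⟩ := Int.eq_ofNat_of_zero_le he
  rw [Sg_nat] at hp
  have h1 : p.IsHomogeneous m := hp
  rw [Int.toNat_natCast, eval_eq, eval_eq, Finset.mul_sum]
  refine Finset.sum_congr rfl fun e he => ?_
  have hd : ∑ i, e i = m := by
    have := h1 (mem_support_iff.1 he)
    have h5 : Finsupp.degree e = m := by rw [← this, Finsupp.degree_eq_weight_one]; rfl
    rw [← h5, Finsupp.degree_eq_sum]
  have hprod : ∏ i ∈ e.support, (t • l) i ^ e i = t ^ m * ∏ i ∈ e.support, l i ^ e i := by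
    rw [← hd, ← Finset.prod_pow_eq_pow_sum]
    have : ∏ i, t ^ e i = ∏ i ∈ e.support, t ^ e i := by
      symm
      apply Finset.prod_subset (Finset.subset_univ _)
      intro i _ hi
      rw [Finsupp.notMem_support_iff.1 hi, pow_zero]
    rw [this, ← Finset.prod_mul_distrib]
    simp [mul_pow]
  rw [hprod]; ring

lemma EX_base (hD : IsCx h τ D) {N : ℕ} (hF : FibEx h D N) {i : ℕ} (hi : i ≤ N)
    {W : Submodule k (Fin 4 → k)} (hW : Module.finrank k W = 1) : EX h τ D i W 0 := by
  obtain ⟨l, hl, hspan⟩ := finrank_eq_one_iff'.1 hW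
  have hl0 : (l : Fin 4 → k) ≠ 0 := by simpa using hl
  intro z hz hzc
  rw [mem_Fc] at hz
  obtain ⟨ω, hω, hω'⟩ := hF l hl0 i hi (fun a => eval (l : Fin 4 → k) (z a))
    (fun a ha => by rw [(hz a).2 ha, map_zero])
    (by
      funext a
      have := hzc a l l.2
      simpa [Matrix.mulVec, dotProduct] using this)
  obtain ⟨φ, hφ⟩ : ∃ φ : Module.Dual k (Fin 4 → k), φ l = 1 := by
    obtain ⟨j, hj⟩ := Function.ne_iff.1 hl0
    refine ⟨((l : Fin 4 → k) j)⁻¹ • LinearMap.proj j, ?_⟩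
    have hj' : (l : Fin 4 → k) j ≠ 0 := hj
    simp [hj']
  refine ⟨fun b => C (ω b) * lf φ ^ τ b, ?_, ?_⟩
  · rw [mem_Fc]
    intro b
    constructor
    · intro hb
      rw [zero_add, Sg_nat]
      have := ((lf_homog φ).pow (τ b)).C_mul (ω b)
      simpa using this
    · intro hb
      rw [hω b hb]; simp
  · rintro a v hv
    obtain ⟨t, ht⟩ := hspan ⟨v, hv⟩
    have hv' : v = t • (l : Fin 4 → k) := (congrArg Subtype.val ht).symm
    subst hv'
    rw [map_sub, sub_eq_zero]
    by_cases ha : h a = i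
    · have h1 := (hz a).1 ha
      rw [eval_smul_Sg h1, zero_add, Int.toNat_natCast, ← congrFun hω' a]
      simp only [Matrix.mulVec, dotProduct, map_sum, Finset.mul_sum, Matrix.map_apply, map_mul]
      refine Finset.sum_congr rfl fun b _ => ?_
      rw [eval_smul_Sg (hD.deg a b), eval_C, map_pow, eval_lf, map_smul, hφ]
      by_cases hab : τ b ≤ τ a
      · have : (τ a : ℤ) - τ b = ((τ a - τ b : ℕ) : ℤ) := by omega
        rw [this, Int.toNat_natCast, smul_eq_mul, mul_one]
        have h2 : t ^ τ a = t ^ (τ a - τ b) * t ^ τ b := by rw [← pow_add]; congr 1; omega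
        rw [h2]; ring
      · have h3 := hD.deg a b
        rw [Sg_neg (by omega), Submodule.mem_bot] at h3
        simp [h3]
    · rw [(hz a).2 ha, map_zero]
      symm
      simp only [Matrix.mulVec, dotProduct, map_sum]
      refine Finset.sum_eq_zero fun b _ => ?_
      by_cases hb : h b = i + 1
      · rw [hD.supp a b (by omega)]; simp
      · rw [hω b hb]; simp

lemma EX_all [IsAlgClosed k] (hD : IsCx h τ D) {N : ℕ} (hF : FibEx h D N) (n : ℕ) :
    ∀ (W : Submodule k (Fin 4 → k)), Module.finrank k W = n + 1 → ∀ i, i + n ≤ N →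
      EX h τ D i W (-(n : ℤ)) := by
  induction n with
  | zero =>
    intro W hW i hi
    simpa using EX_base hD hF (by omega) (by simpa using hW)
  | succ n ih =>
    intro W hW i hi
    have h1 : (-((n + 1 : ℕ) : ℤ)) = -(n : ℤ) - 1 := by push_cast; ring
    rw [h1]
    apply EX_step hD (by omega)
    intro φ hφ
    have hfr : Module.finrank k (W ⊓ LinearMap.ker φ : Submodule k (Fin 4 → k)) = n + 1 := by
      let r : W →ₗ[k] k := φ.domRestrict W
      have hr : r ≠ 0 := by
        intro h0
        apply hφ
        intro v hv
        exact congrArg (fun g => g ⟨v, hv⟩) h0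
      have h2 := LinearMap.finrank_range_add_finrank_ker r
      rw [LinearMap.range_eq_top.2 (LinearMap.surjective hr), finrank_top, Module.finrank_self, hW] at h2
      have h3 : Module.finrank k (LinearMap.ker r) = Module.finrank k ((LinearMap.ker r).map W.subtype) :=
        (LinearEquiv.finrank_eq (Submodule.equivMapOfInjective _ W.subtype_injective _))
      have h4 : (LinearMap.ker r).map W.subtype = W ⊓ LinearMap.ker φ := by
        ext v
        simp [r, and_comm]
      rw [h4] at h3
      omega
    exact ⟨ih _ hfr i (by omega), ih _ hfr (i + 1) (by omega)⟩
end cx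
end partPC2

section partPD
open scoped Kronecker
set_option linter.unusedSectionVars false

section tens
variable {κ κ' : Type} [Fintype κ] [DecidableEq κ] [Fintype κ'] [DecidableEq κ']

section kr
variable {R : Type} [CommRing R] (A B : Matrix κ κ R) (A' B' : Matrix κ' κ' R)
lemma neg_kron' : (-A) ⊗ₖ A' = -(A ⊗ₖ A') := by ext ⟨a, a'⟩ ⟨b, b'⟩; simp
lemma kron_neg' : A ⊗ₖ (-A') = -(A ⊗ₖ A') := by ext ⟨a, a'⟩ ⟨b, b'⟩; simp
lemma sub_kron' : (A - B) ⊗ₖ A' = A ⊗ₖ A' - B ⊗ₖ A' := by ext ⟨a, a'⟩ ⟨b, b'⟩; simp [sub_mul]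
lemma kron_sub' : A ⊗ₖ (A' - B') = A ⊗ₖ A' - A ⊗ₖ B' := by ext ⟨a, a'⟩ ⟨b, b'⟩; simp [mul_sub]
end kr

def sgn (R : Type) [CommRing R] (h : κ → ℕ) : Matrix κ κ R := Matrix.diagonal fun a => (-1) ^ h a

lemma sgn_sq (R : Type) [CommRing R] (h : κ → ℕ) : sgn R h * sgn R h = 1 := by
  rw [sgn, Matrix.diagonal_mul_diagonal, ← Matrix.diagonal_one]
  congr 1
  funext a
  rw [← mul_pow]; simp

lemma sgn_anti {R : Type} [CommRing R] {h : κ → ℕ} {D : Matrix κ κ R}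
    (hD : ∀ a b, h b ≠ h a + 1 → D a b = 0) : sgn R h * D = - (D * sgn R h) := by
  ext a b
  rw [sgn, Matrix.diagonal_mul, Matrix.neg_apply, Matrix.mul_diagonal]
  by_cases hab : h b = h a + 1
  · rw [hab, pow_succ]; ring
  · rw [hD a b hab]; simp

def ten {R : Type} [CommRing R] (h : κ → ℕ) (D : Matrix κ κ R) (D' : Matrix κ' κ' R) :
    Matrix (κ × κ') (κ × κ') R := D ⊗ₖ 1 + sgn R h ⊗ₖ D'

lemma ten_sq {R : Type} [CommRing R] {h : κ → ℕ} {D : Matrix κ κ R} {D' : Matrix κ' κ' R}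
    (hD : sgn R h * D = - (D * sgn R h)) (hs : D * D = 0) (hs' : D' * D' = 0) :
    ten h D D' * ten h D D' = 0 := by
  simp only [ten, add_mul, mul_add, ← Matrix.mul_kronecker_mul, hs, hs', hD, one_mul, mul_one]
  simp
  rw [← Matrix.add_kronecker]; simp

lemma ten_isCx {h τ : κ → ℕ} {h' τ' : κ' → ℕ} {D : Matrix κ κ (MvPolynomial (Fin 4) k)}
    {D' : Matrix κ' κ' (MvPolynomial (Fin 4) k)} (hD : IsCx h τ D) (hD' : IsCx h' τ' D') :
    IsCx (fun x : κ × κ' => h x.1 + h' x.2) (fun x => τ x.1 + τ' x.2) (ten h D D') where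
  deg := by
    rintro ⟨a, a'⟩ ⟨b, b'⟩
    simp only [ten, Matrix.add_apply, Matrix.kroneckerMap_apply]
    refine Submodule.add_mem _ ?_ ?_
    · by_cases hab : a' = b'
      · subst hab
        have := hD.deg a b
        simp only [Matrix.one_apply_eq, mul_one]
        convert this using 2
        push_cast; ring
      · simp [Matrix.one_apply_ne hab]
    · by_cases hab : a = b
      · subst hab
        have := hD'.deg a' b'
        have h2 := Submodule.smul_mem _ ((-1 : k) ^ h a) this
        simp only [sgn, Matrix.diagonal_apply_eq]
        rw [smul_eq_C_mul] at h2
        convert h2 using 2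
        · push_cast; ring
        · simp
      · simp [sgn, Matrix.diagonal_apply_ne _ hab]
  supp := by
    rintro ⟨a, a'⟩ ⟨b, b'⟩ hab
    simp only [ten, Matrix.add_apply, Matrix.kroneckerMap_apply]
    simp only at hab
    have h1 : D a b * (1 : Matrix κ' κ' (MvPolynomial (Fin 4) k)) a' b' = 0 := by
      by_cases h0 : a' = b'
      · subst h0
        rw [hD.supp a b (by omega), zero_mul]
      · rw [Matrix.one_apply_ne h0, mul_zero]
    have h2 : sgn (MvPolynomial (Fin 4) k) h a b * D' a' b' = 0 := by
      by_cases h0 : a = b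
      · subst h0
        rw [hD'.supp a' b' (by omega), mul_zero]
      · rw [sgn, Matrix.diagonal_apply_ne _ h0, zero_mul]
    rw [h1, h2, add_zero]
  sq := ten_sq (sgn_anti hD.supp) hD.sq hD'.sq

/-- contracting homotopy up to a projection on degree `m` -/
def Ht (h : κ → ℕ) (δ : Matrix κ κ k) (m : ℕ) : Prop :=
  ∃ s π : Matrix κ κ k, δ * s + s * δ = 1 - π ∧ sgn k h * s = - (s * sgn k h) ∧
    ∀ a b, h b ≠ m → π a b = 0

lemma ten_Ht {h : κ → ℕ} {h' : κ' → ℕ} {δ : Matrix κ κ k} {δ' : Matrix κ' κ' k} {m m' : ℕ}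
    (ha : sgn k h * δ = - (δ * sgn k h)) (hs : δ * δ = 0) (hs' : δ' * δ' = 0)
    (H : Ht h δ m) (H' : Ht h' δ' m') :
    Ht (fun x : κ × κ' => h x.1 + h' x.2) (ten h δ δ') (m + m') := by
  obtain ⟨s, π, h1, h2, h3⟩ := H
  obtain ⟨s', π', h1', h2', h3'⟩ := H'
  set σ := sgn k h with hσ
  have hSg : sgn k (fun x : κ × κ' => h x.1 + h' x.2) = σ ⊗ₖ sgn k h' := by
    simp only [hσ, sgn, Matrix.diagonal_kronecker_diagonal, pow_add]
  have hd2 : ten h δ δ' * ten h δ δ' = 0 := ten_sq ha hs hs'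
  have e1 : ten h δ δ' * (s ⊗ₖ 1) + (s ⊗ₖ 1) * ten h δ δ' = 1 - π ⊗ₖ 1 := by
    simp only [ten, add_mul, mul_add, ← Matrix.mul_kronecker_mul, one_mul, mul_one, ← hσ, h2]
    have : (1 : Matrix (κ × κ') (κ × κ') k) - π ⊗ₖ 1 = (δ * s) ⊗ₖ 1 + (s * δ) ⊗ₖ 1 := by
      rw [← Matrix.add_kronecker, h1, ← Matrix.one_kronecker_one, sub_kron']
    rw [this]
    rw [neg_kron']
    abel
  have e2 : ten h δ δ' * (σ ⊗ₖ s') + (σ ⊗ₖ s') * ten h δ δ' = 1 - 1 ⊗ₖ π' := by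
    simp only [ten, add_mul, mul_add, ← Matrix.mul_kronecker_mul, one_mul, mul_one, ← hσ, ha]
    have : (1 : Matrix (κ × κ') (κ × κ') k) - 1 ⊗ₖ π' = (σ * σ) ⊗ₖ (δ' * s') + (σ * σ) ⊗ₖ (s' * δ') := by
      rw [← Matrix.kronecker_add, h1', hσ, sgn_sq, ← Matrix.one_kronecker_one, kron_sub']
    rw [this]
    rw [neg_kron']
    abel
  have e3 : ten h δ δ' * (π ⊗ₖ 1) = (π ⊗ₖ 1) * ten h δ δ' := by
    have h6 : (π ⊗ₖ (1 : Matrix κ' κ' k)) = 1 - (ten h δ δ' * (s ⊗ₖ 1) + (s ⊗ₖ 1) * ten h δ δ') := by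
      rw [e1]; simp
    rw [h6]
    simp only [mul_sub, sub_mul, mul_add, add_mul, mul_one, one_mul]
    rw [← mul_assoc, hd2, mul_assoc, mul_assoc (s ⊗ₖ 1), hd2]
    simp
  have hπσ : σ * π = π * σ := by
    have h6 : π = 1 - (δ * s + s * δ) := by rw [h1]; simp
    rw [h6]
    simp only [mul_sub, sub_mul, mul_add, add_mul, mul_one, one_mul]
    rw [← mul_assoc σ, ha, ← mul_assoc σ, h2, neg_mul, neg_mul, mul_assoc, h2, mul_assoc s σ δ, ha]
    simp [mul_assoc]
  refine ⟨s ⊗ₖ 1 + (σ ⊗ₖ s') * (π ⊗ₖ 1), π ⊗ₖ π', ?_, ?_, ?_⟩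
  · have h7 : π ⊗ₖ π' = (1 ⊗ₖ π') * (π ⊗ₖ (1 : Matrix κ' κ' k)) := by
      rw [← Matrix.mul_kronecker_mul]; simp
    rw [mul_add, add_mul, mul_assoc, ← e3, ← mul_assoc, ← mul_assoc, add_add_add_comm, e1, ← add_mul, e2,
      h7, sub_mul, one_mul]
    abel
  · rw [hSg]
    simp only [mul_add, add_mul, ← Matrix.mul_kronecker_mul, one_mul, mul_one, h2, h2']
    rw [mul_assoc σ π σ, ← hπσ]
    simp only [neg_kron', kron_neg']
    abel
  · rintro ⟨a, a'⟩ ⟨b, b'⟩ hb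
    simp only at hb
    rw [Matrix.kroneckerMap_apply]
    by_cases hb1 : h b = m
    · rw [h3' a' b' (by omega), mul_zero]
    · rw [h3 a b hb1, zero_mul]

lemma FibEx_of_Ht {h τ : κ → ℕ} {D : Matrix κ κ (MvPolynomial (Fin 4) k)} (hD : IsCx h τ D) {N : ℕ}
    (H : ∀ l : Fin 4 → k, l ≠ 0 → Ht h (D.map (eval l)) (N + 1)) : FibEx h D N := by
  intro l hl i hi ζ hζ hc
  obtain ⟨s, π, h1, h2, h3⟩ := H l hl
  set δ := D.map (eval l)
  have hπ : π.mulVec ζ = 0 := by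
    funext a
    simp only [Matrix.mulVec, dotProduct]
    refine Finset.sum_eq_zero fun b _ => ?_
    by_cases hb : h b = N + 1
    · rw [hζ b (by omega), mul_zero]
    · rw [h3 a b hb, zero_mul]
  have h4 : δ.mulVec (s.mulVec ζ) = ζ := by
    have := congrArg (fun M => Matrix.mulVec M ζ) h1
    simp only [Matrix.add_mulVec, Matrix.sub_mulVec, Matrix.one_mulVec, hπ, ← Matrix.mulVec_mulVec, hc,
      Matrix.mulVec_zero] at this
    simpa using this
  refine ⟨fun b => if h b = i + 1 then s.mulVec ζ b else 0, fun b hb => if_neg hb, ?_⟩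
  funext a
  by_cases ha : h a = i
  · rw [← congrFun h4 a]
    refine Finset.sum_congr rfl fun b _ => ?_
    by_cases hb : h b = i + 1
    · simp [hb]
    · have : δ a b = 0 := by simp [δ, hD.supp a b (by omega)]
      simp [this]
  · rw [hζ a ha]
    refine Finset.sum_eq_zero fun b _ => ?_
    by_cases hb : h b = i + 1
    · have : δ a b = 0 := by simp [δ, hD.supp a b (by omega)]
      simp [this]
    · simp [hb]

lemma ten_map {R S : Type} [CommRing R] [CommRing S] (f : R →+* S) (h : κ → ℕ) (D : Matrix κ κ R)
    (D' : Matrix κ' κ' R) : (ten h D D').map f = ten h (D.map f) (D'.map f) := by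
  ext ⟨a, a'⟩ ⟨b, b'⟩
  simp [ten, sgn, Matrix.diagonal_apply, Matrix.one_apply, apply_ite f]

end tens
end partPD

section partPD2
open scoped Kronecker
set_option linter.unusedSectionVars false

section base
variable {β : Type} [Fintype β] [DecidableEq β]

abbrev KK (β : Type) := β ⊕ (Fin 7 ⊕ Unit)

def hK : KK β → ℕ
  | .inl _ => 2
  | .inr (.inl _) => 1
  | .inr (.inr _) => 0

def tK : KK β → ℕ
  | .inl _ => 0
  | .inr (.inl _) => 1
  | .inr (.inr _) => 3

def DK (q : Fin 7 → MvPolynomial (Fin 4) k) (u : β → Fin 7 → Fin 4 → k) :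
    Matrix (KK β) (KK β) (MvPolynomial (Fin 4) k) := Matrix.of fun a b =>
  match a, b with
  | .inr (.inl j), .inl b => ∑ i, C (u b j i) * X i
  | .inr (.inr _), .inr (.inl j) => q j
  | _, _ => 0

variable {q : Fin 7 → MvPolynomial (Fin 4) k} {u : β → Fin 7 → Fin 4 → k}

lemma DK_isCx (hq : ∀ j, (q j).IsHomogeneous 2)
    (hu : ∀ b, ∑ j, q j * ∑ i, C (u b j i) * X i = 0) : IsCx hK tK (DK q u) where
  deg := by
    rintro (a | a | a) (b | b | b) <;> simp only [DK, Matrix.of_apply, Submodule.zero_mem, tK]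
    · have := Sg_nat (k := k) 1
      simp only [Nat.cast_one, Nat.cast_zero, sub_zero] at this ⊢
      rw [this]
      exact IsHomogeneous.sum _ _ _ fun i _ => (isHomogeneous_X k i).C_mul _
    · have := Sg_nat (k := k) 2
      have h2 : ((3 : ℕ) : ℤ) - ((1 : ℕ) : ℤ) = ((2 : ℕ) : ℤ) := by norm_num
      rw [h2, this]
      exact hq b
  supp := by
    rintro (a | a | a) (b | b | b) hab <;> simp [DK, hK] at hab ⊢
  sq := by
    ext1 a b
    rw [Matrix.mul_apply]
    rcases a with (a | a | a) <;> rcases b with (b | b | b) <;>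
      simp [DK, Fintype.sum_sum_type, hu]

lemma DK_Ht
    {l : Fin 4 → k} (ha : ∃ j, eval l (q j) ≠ 0)
    (hb : ∀ c : Fin 7 → k, ∑ j, c j * eval l (q j) = 0 →
      ∃ x : β → k, ∀ j, ∑ b, (∑ i, u b j i * l i) * x b = c j) :
    Ht hK ((DK q u).map (eval l)) 2 := by
  obtain ⟨j0, hj0⟩ := ha
  set p : Fin 7 → k := fun j => eval l (q j) with hp
  let e : Fin 7 → k := fun j => if j = j0 then (p j0)⁻¹ else 0
  have he : ∑ j, p j * e j = 1 := by simp [e, hj0, hp]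
  have hc : ∀ j, ∃ x : β → k, ∀ j', ∑ b, (∑ i, u b j' i * l i) * x b =
      (if j' = j then 1 else 0) - e j' * p j := by
    intro j
    apply hb
    simp only [sub_mul, Finset.sum_sub_distrib]
    have : ∑ x, e x * p j * (eval l) (q x) = (∑ x, p x * e x) * p j := by
      rw [Finset.sum_mul]; refine Finset.sum_congr rfl fun x _ => ?_; simp only [hp]; ring
    rw [this, he]
    simp [hp]
  choose x hx using hc
  let s : Matrix (KK β) (KK β) k := Matrix.of fun a b =>
    match a, b with
    | .inr (.inl j), .inr (.inr _) => e j
    | .inl b, .inr (.inl j) => x j b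
    | _, _ => 0
  refine ⟨s, 1 - ((DK q u).map (eval l) * s + s * (DK q u).map (eval l)), by simp, ?_, ?_⟩
  · ext a b
    rw [sgn, Matrix.diagonal_mul, Matrix.neg_apply, Matrix.mul_diagonal]
    rcases a with (a | a | a) <;> rcases b with (b | b | b) <;> simp [s, hK]
  · intro a b hb
    rw [Matrix.sub_apply, Matrix.add_apply, Matrix.mul_apply, Matrix.mul_apply]
    rcases a with (a | a | a) <;> rcases b with (b | b | b) <;>
      simp [DK, s, hK, Fintype.sum_sum_type, Matrix.one_apply] at hb ⊢
    · rw [hx]; simp [hp]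
    · have : ∑ j, (eval l) (q j) * e j = 1 := he
      rw [this]; simp

lemma single_Fc {ι : Type} [Fintype ι] [DecidableEq ι] {h τ : ι → ℕ} {i : ℕ} {d : ℤ} {x : ι}
    {s : MvPolynomial (Fin 4) k} (hx : h x = i) (hs : s ∈ Sg k (d + τ x)) :
    (Pi.single x s : ι → MvPolynomial (Fin 4) k) ∈ Fc k h τ i d := by
  rw [mem_Fc]
  intro a
  by_cases ha : a = x
  · subst ha
    simp [hx, hs]
  · simp [ha]

lemma cube_mem [IsAlgClosed k] (h2 : (2 : k) ≠ 0) (hq : ∀ j, (q j).IsHomogeneous 2)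
    (hu : ∀ b, ∑ j, q j * ∑ i, C (u b j i) * X i = 0)
    (ha : ∀ l : Fin 4 → k, l ≠ 0 → ∃ j, eval l (q j) ≠ 0)
    (hb : ∀ l : Fin 4 → k, l ≠ 0 → ∀ c : Fin 7 → k, ∑ j, c j * eval l (q j) = 0 →
      ∃ x : β → k, ∀ j, ∑ b, (∑ i, u b j i * l i) * x b = c j)
    {s : MvPolynomial (Fin 4) k} (hs : s.IsHomogeneous 2) (j j' : Fin 7) :
    s * q j * q j' ∈ (Submodule.span k (Set.range q)) ^ 3 := by
  have : Infinite k := IsAlgClosed.instInfinite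
  set D := DK q u with hDdef
  have hD : IsCx hK tK D := DK_isCx hq hu
  have hDD := ten_isCx hD hD
  have hT := ten_isCx hDD hD
  set T := ten (fun x : KK β × KK β => hK x.1 + hK x.2) (ten hK D D) D with hTdef
  have hev : ∀ l, (D.map (eval l)) * (D.map (eval l)) = 0 := by
    intro l
    rw [← Matrix.map_mul, hD.sq]; simp
  have hsg : ∀ l, sgn k hK * (D.map (eval l)) = - ((D.map (eval l)) * sgn k hK) := by
    intro l
    apply sgn_anti
    intro a b hab
    simp [hD.supp a b hab]
  have hF : FibEx (fun x : (KK β × KK β) × KK β => (hK x.1.1 + hK x.1.2) + hK x.2) T 5 := by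
    apply FibEx_of_Ht hT
    intro l hl
    have H := DK_Ht (u := u) (ha l hl) (hb l hl)
    have H2 := ten_Ht (hsg l) (hev l) (hev l) H H
    rw [hTdef, ten_map, ten_map]
    refine ten_Ht (m := 2 + 2) (m' := 2) ?_ ?_ (hev l) H2 H
    · rw [← ten_map]
      apply sgn_anti
      intro a b hab
      simp [hDD.supp a b hab]
    · exact ten_sq (hsg l) (hev l) (hev l)
  have hE := EX_all hT hF 3 ⊤ (by simp) 2 (by norm_num)
  let y : Fin 7 → KK β := fun j => .inr (.inl j)
  let ε : KK β := .inr (.inr ())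
  have hs2 : s ∈ Sg k ((2 : ℕ) : ℤ) := by rw [Sg_nat]; exact hs
  have hmem : ∀ x : (KK β × KK β) × KK β, (hK x.1.1 + hK x.1.2) + hK x.2 = 2 →
      tK x.1.1 + tK x.1.2 + tK x.2 = 5 → (Pi.single x s : (KK β × KK β) × KK β → _) ∈
      Fc k (fun x : (KK β × KK β) × KK β => (hK x.1.1 + hK x.1.2) + hK x.2)
        (fun x => tK x.1.1 + tK x.1.2 + tK x.2) 2 (-((3 : ℕ) : ℤ)) := by
    intro x hx hx'
    refine single_Fc hx ?_
    rw [hx']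
    exact hs2
  obtain ⟨w, hw, hw'⟩ := hE (Pi.single ((y j, y j'), ε) s + Pi.single ((y j', y j), ε) s
      - Pi.single ((y j, ε), y j') s - Pi.single ((y j', ε), y j) s
      + Pi.single ((ε, y j), y j') s + Pi.single ((ε, y j'), y j) s)
    (by
      refine Submodule.add_mem _ (Submodule.add_mem _ (Submodule.sub_mem _ (Submodule.sub_mem _
        (Submodule.add_mem _ ?_ ?_) ?_) ?_) ?_) ?_ <;> exact hmem _ rfl rfl)
    (by
      rintro ⟨⟨r1, r2⟩, r3⟩
      have hDy : ∀ r j, D r (y j) = q j * (1 : Matrix (KK β) (KK β) (MvPolynomial (Fin 4) k)) r ε := by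
        rintro (r | r | r) j <;> simp [D, DK, y, ε, Matrix.one_apply]
      have hDe : ∀ r, D r ε = 0 := by
        rintro (r | r | r) <;> simp [D, DK, ε]
      have hsy : ∀ r j, sgn (MvPolynomial (Fin 4) k) hK r (y j) =
          - (1 : Matrix (KK β) (KK β) (MvPolynomial (Fin 4) k)) r (y j) := by
        intro r j
        simp only [sgn, Matrix.diagonal_apply, Matrix.one_apply]
        split_ifs with h
        · subst h; simp [hK, y]
        · simp
      have hse : ∀ r, sgn (MvPolynomial (Fin 4) k) hK r ε =
          (1 : Matrix (KK β) (KK β) (MvPolynomial (Fin 4) k)) r ε := by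
        intro r
        simp only [sgn, Matrix.diagonal_apply, Matrix.one_apply]
        split_ifs with h
        · subst h; simp [hK, ε]
        · simp
      have hss : ∀ r r' x x', sgn (MvPolynomial (Fin 4) k) (fun x : KK β × KK β => hK x.1 + hK x.2)
          (r, r') (x, x') = sgn _ hK r x * sgn _ hK r' x' := by
        intro r r' x x'
        simp only [sgn, Matrix.diagonal_apply, Prod.mk.injEq]
        by_cases h1 : r = x <;> by_cases h2 : r' = x' <;> simp [h1, h2, pow_add]
      suffices h0 : T.mulVec (Pi.single ((y j, y j'), ε) s + Pi.single ((y j', y j), ε) s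
        - Pi.single ((y j, ε), y j') s - Pi.single ((y j', ε), y j) s
        + Pi.single ((ε, y j), y j') s + Pi.single ((ε, y j'), y j) s) ((r1, r2), r3) = 0 by
        rw [h0]; exact Ideal.zero_mem _
      simp only [Matrix.mulVec_add, Matrix.mulVec_sub, Pi.add_apply, Pi.sub_apply, Matrix.mulVec_single,
        Matrix.col_apply, Pi.smul_apply, MulOpposite.smul_eq_mul_unop, MulOpposite.unop_op]
      simp only [T, ten, Matrix.add_apply, Matrix.kroneckerMap_apply, hss, hsy, hse, hDy, hDe]
      ring)
  have hz : ∀ a, (Pi.single ((y j, y j'), ε) s + Pi.single ((y j', y j), ε) s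
      - Pi.single ((y j, ε), y j') s - Pi.single ((y j', ε), y j) s
      + Pi.single ((ε, y j), y j') s + Pi.single ((ε, y j'), y j) s :
        (KK β × KK β) × KK β → MvPolynomial (Fin 4) k) a = T.mulVec w a := by
    intro a
    rw [← sub_eq_zero]
    apply MvPolynomial.funext
    intro v
    rw [hw' a v trivial, map_zero]
  let lam : KK β → MvPolynomial (Fin 4) k := D ε
  have hlamy : ∀ j, lam (y j) = q j := by intro j; simp [lam, D, DK, ε, y]
  have hlame : lam ε = 0 := by simp [lam, D, DK, ε]
  have hlamu : ∀ b, lam (.inl b) = 0 := by intro b; simp [lam, D, DK, ε]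
  have hlamD : ∀ x, ∑ r, lam r * D r x = 0 := by
    intro x
    have := congrArg (fun M => M ε x) hD.sq
    simpa [Matrix.mul_apply] using this
  have hlams : ∀ r x, lam r * sgn (MvPolynomial (Fin 4) k) hK r x = - (lam r * (1 : Matrix _ _ _) r x) := by
    rintro (r | r | r) x
    · rw [hlamu]; simp
    · simp only [sgn, Matrix.diagonal_apply, Matrix.one_apply]
      split_ifs <;> simp [hK]
    · have := hlame
      simp only [ε] at this
      rw [this]; simp
  let Lam : (KK β × KK β) × KK β → MvPolynomial (Fin 4) k := fun r =>
    lam r.1.1 * lam r.1.2 * (1 : Matrix (KK β) (KK β) (MvPolynomial (Fin 4) k)) ε r.2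
  have hLT : ∀ x : (KK β × KK β) × KK β, ∑ r, Lam r * T r x = lam x.1.1 * lam x.1.2 * lam x.2 := by
    rintro ⟨⟨x1, x2⟩, x3⟩
    have hss : ∀ r r' x x', sgn (MvPolynomial (Fin 4) k) (fun x : KK β × KK β => hK x.1 + hK x.2)
        (r, r') (x, x') = sgn _ hK r x * sgn _ hK r' x' := by
      intro r r' x x'
      simp only [sgn, Matrix.diagonal_apply, Prod.mk.injEq]
      by_cases h1 : r = x <;> by_cases h2 : r' = x' <;> simp [h1, h2, pow_add]
    have hcol : ∀ x, ∑ r, lam r * (1 : Matrix (KK β) (KK β) (MvPolynomial (Fin 4) k)) r x = lam x := by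
      intro x; simp [Matrix.one_apply]
    have hterm : ∀ r1 r2, ∑ r3, Lam ((r1, r2), r3) * T ((r1, r2), r3) ((x1, x2), x3) =
        (lam r1 * D r1 x1) * (lam r2 * (1 : Matrix _ _ _) r2 x2) * (1 : Matrix _ _ _) ε x3
        - (lam r1 * (1 : Matrix _ _ _) r1 x1) * (lam r2 * D r2 x2) * (1 : Matrix _ _ _) ε x3
        + (lam r1 * (1 : Matrix _ _ _) r1 x1) * (lam r2 * (1 : Matrix _ _ _) r2 x2) * lam x3 := by
      intro r1 r2
      rw [Finset.sum_eq_single ε]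
      · simp only [Lam, T, ten, Matrix.add_apply, Matrix.kroneckerMap_apply, hss, Matrix.one_apply_eq]
        have e1 := hlams r1 x1
        have e2 := hlams r2 x2
        have e3 : D ε x3 = lam x3 := rfl
        rw [e3]
        linear_combination (lam r2 * D r2 x2 * (1 : Matrix _ _ _) ε x3
          + lam x3 * lam r2 * sgn _ hK r2 x2) * e1 - lam x3 * (lam r1 * (1 : Matrix _ _ _) r1 x1) * e2
      · intro b _ hb
        simp only [Lam, Matrix.one_apply_ne (Ne.symm hb), mul_zero, zero_mul]
      · simp
    have hfac : ∀ (A B : KK β → MvPolynomial (Fin 4) k) (c : MvPolynomial (Fin 4) k),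
        ∑ r1, ∑ r2, A r1 * B r2 * c = (∑ r, A r) * (∑ r, B r) * c := by
      intro A B c
      rw [Finset.sum_mul_sum, Finset.sum_mul]
      refine Finset.sum_congr rfl fun r _ => ?_
      rw [Finset.sum_mul]
    rw [Fintype.sum_prod_type, Fintype.sum_prod_type]
    simp only [hterm, Finset.sum_add_distrib, Finset.sum_sub_distrib]
    rw [hfac, hfac, hfac, hlamD, hlamD, hcol, hcol]
    ring
  have hmain : ∑ r, Lam r * T.mulVec w r = ∑ x : (KK β × KK β) × KK β, lam x.1.1 * lam x.1.2 * lam x.2 * w x := by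
    simp only [Matrix.mulVec, dotProduct, Finset.mul_sum]
    rw [Finset.sum_comm]
    refine Finset.sum_congr rfl fun x _ => ?_
    rw [← hLT, Finset.sum_mul]
    refine Finset.sum_congr rfl fun r _ => ?_
    ring
  have hlhs : ∑ r, Lam r * T.mulVec w r = 2 * (s * q j * q j') := by
    simp only [← hz]
    have hne : ∀ j, (1 : Matrix (KK β) (KK β) (MvPolynomial (Fin 4) k)) ε (y j) = 0 := by
      intro j; simp [Matrix.one_apply, ε, y]
    simp only [Pi.add_apply, Pi.sub_apply, mul_add, mul_sub, Finset.sum_add_distrib,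
      Finset.sum_sub_distrib]
    have hsum : ∀ x, ∑ r, Lam r * (Pi.single x s : (KK β × KK β) × KK β → MvPolynomial (Fin 4) k) r = Lam x * s := by
      intro x
      rw [Finset.sum_eq_single x]
      · simp
      · intro b _ hb; simp [hb]
      · simp
    simp only [hsum, Lam, hne, hlamy, hlame, Matrix.one_apply_eq]
    ring
  have hmem3 : ∑ x : (KK β × KK β) × KK β, lam x.1.1 * lam x.1.2 * lam x.2 * w x ∈
      (Submodule.span k (Set.range q)) ^ 3 := by
    have hqm : ∀ j, q j ∈ Submodule.span k (Set.range q) := fun j =>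
      Submodule.subset_span ⟨j, rfl⟩
    refine Submodule.sum_mem _ ?_
    rintro ⟨⟨x1, x2⟩, x3⟩ -
    simp only
    have hcase : ∀ x : KK β, lam x = 0 ∨ ∃ j, x = y j := by
      rintro (x | x | x)
      · exact Or.inl (hlamu x)
      · exact Or.inr ⟨x, rfl⟩
      · exact Or.inl hlame
    rcases hcase x1 with h1 | ⟨j1, rfl⟩
    · rw [h1]; simp
    rcases hcase x2 with h1 | ⟨j2, rfl⟩
    · rw [h1]; simp
    rcases hcase x3 with h1 | ⟨j3, rfl⟩
    · rw [h1]; simp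
    have hw0 := ((mem_Fc.1 hw) ((y j1, y j2), y j3)).1 rfl
    have hd : (-((3 : ℕ) : ℤ)) + (((tK (y j1) + tK (y j2)) + tK (y j3) : ℕ) : ℤ) = ((0 : ℕ) : ℤ) := by
      simp [tK, y]
    rw [hd, Sg_nat] at hw0
    obtain ⟨c, hc⟩ : ∃ c, w ((y j1, y j2), y j3) = C c := by
      have h0 : (w ((y j1, y j2), y j3)).IsHomogeneous 0 := hw0
      exact ⟨_, totalDegree_eq_zero_iff_eq_C.1 (Nat.le_zero.1 h0.totalDegree_le)⟩
    rw [hc, mul_comm, ← smul_eq_C_mul, hlamy, hlamy, hlamy, pow_succ, pow_two]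
    exact Submodule.smul_mem _ _ (Submodule.mul_mem_mul (Submodule.mul_mem_mul (hqm _) (hqm _)) (hqm _))
  rw [← hmain, hlhs] at hmem3
  have := Submodule.smul_mem _ (2 : k)⁻¹ hmem3
  rw [smul_eq_C_mul, ← mul_assoc] at this
  have h22 : (C (2 : k)⁻¹ * 2 : MvPolynomial (Fin 4) k) = 1 := by
    have : (2 : MvPolynomial (Fin 4) k) = C 2 := (map_ofNat C 2).symm
    rw [this, ← C_mul, inv_mul_cancel₀ h2, C_1]
  rwa [h22, one_mul] at this
end base
end partPD2

section partPA
lemma finrank_homog (n d : ℕ) : Module.finrank k (homogeneousSubmodule (Fin n) k d) =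
    (n + d - 1).choose d := by
  have h : homogeneousSubmodule (Fin n) k d = Submodule.span k
      (Set.range fun m : (Finset.univ : Finset (Fin n)).finsuppAntidiag d => monomial (m : Fin n →₀ ℕ) (1:k)) := by
    apply le_antisymm
    · intro p hp
      rw [p.as_sum]
      refine Submodule.sum_mem _ fun m hm => ?_
      have : monomial m (coeff m p) = coeff m p • monomial m (1:k) := by simp [smul_monomial]
      rw [this]
      refine Submodule.smul_mem _ _ (Submodule.subset_span ⟨⟨m, ?_⟩, rfl⟩)
      rw [Finset.mem_finsuppAntidiag]
      have h1 := hp (mem_support_iff.1 hm)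
      rw [Pi.one_def, ← Finsupp.degree_eq_weight_one] at h1
      refine ⟨?_, by simp⟩
      rw [← h1, Finsupp.degree_eq_sum]
    · rw [Submodule.span_le]
      rintro _ ⟨m, rfl⟩
      have := m.2
      rw [Finset.mem_finsuppAntidiag] at this
      refine isHomogeneous_monomial _ ?_
      rw [Finsupp.degree_eq_sum]; exact this.1
  rw [h, finrank_span_eq_card]
  · rw [Fintype.card_coe, Finset.card_finsuppAntidiag_nat_eq_choose]; simp
  · have := (basisMonomials (Fin n) k).linearIndependent
    rw [coe_basisMonomials] at this
    exact this.comp _ Subtype.val_injective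

lemma H2_span : homogeneousSubmodule (Fin 4) k 2 =
    Submodule.span k (Set.range fun p : Fin 4 × Fin 4 => (X p.1 * X p.2 : MvPolynomial (Fin 4) k)) := by
  rw [← homogeneousSubmodule_one_pow, pow_two, homogeneousSubmodule_one_eq_span_X, Submodule.span_mul_span]
  congr 1
  ext p
  simp only [Set.mem_mul, Set.mem_range]
  constructor
  · rintro ⟨_, ⟨i, rfl⟩, _, ⟨j, rfl⟩, rfl⟩; exact ⟨(i, j), rfl⟩
  · rintro ⟨⟨i, j⟩, rfl⟩; exact ⟨_, ⟨i, rfl⟩, _, ⟨j, rfl⟩, rfl⟩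

def gramL : MvPolynomial (Fin 4) k →ₗ[k] Matrix (Fin 4) (Fin 4) k where
  toFun := gram
  map_add' p q := by
    ext i j; simp only [gram, Matrix.of_apply, Matrix.add_apply, coeff_add]; split_ifs <;> ring
  map_smul' c q := by
    ext i j; simp only [gram, Matrix.of_apply, Matrix.smul_apply, coeff_smul, smul_eq_mul, RingHom.id_apply]
    split_ifs <;> ring

lemma gramL_apply (p : MvPolynomial (Fin 4) k) : gramL p = gram p := rfl

def quad : Matrix (Fin 4) (Fin 4) k →ₗ[k] MvPolynomial (Fin 4) k where
  toFun M := ∑ i, ∑ j, C (M i j) * (X i * X j)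
  map_add' M N := by simp [add_mul, Finset.sum_add_distrib]
  map_smul' c M := by simp [Finset.smul_sum, smul_eq_C_mul, mul_assoc]

lemma quad_apply (M : Matrix (Fin 4) (Fin 4) k) : quad M = ∑ i, ∑ j, C (M i j) * (X i * X j) := rfl

lemma quad_homog (M : Matrix (Fin 4) (Fin 4) k) : (quad M).IsHomogeneous 2 := by
  rw [quad_apply]
  exact IsHomogeneous.sum _ _ _ fun i _ => IsHomogeneous.sum _ _ _ fun j _ =>
    ((isHomogeneous_X k i).mul (isHomogeneous_X k j)).C_mul _

lemma gram_XX (h2 : (2:k) ≠ 0) (i j a b : Fin 4) : gram (X i * X j : MvPolynomial (Fin 4) k) a b =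
    ((if i = a ∧ j = b then 1 else 0) + (if i = b ∧ j = a then 1 else 0)) / 2 := by
  have e : (X i * X j : MvPolynomial (Fin 4) k) = monomial (Finsupp.single i 1 + Finsupp.single j 1) 1 := by
    simp [X, monomial_mul]
  have e2 : (Finsupp.single a 2 : Fin 4 →₀ ℕ) = Finsupp.single a 1 + Finsupp.single a 1 := by
    rw [← Finsupp.single_add]
  rw [e]
  simp only [gram, Matrix.of_apply, coeff_monomial, e2]
  simp only [Finsupp.single_add_single_eq_single_add_single (one_ne_zero : (1:ℕ) ≠ 0) (one_ne_zero : (1:ℕ) ≠ 0)]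
  by_cases hab : a = b
  · subst hab
    by_cases h : i = a ∧ j = a
    · simp [h]; rw [one_add_one_eq_two, div_self h2]
    · simp [h]
  · by_cases h : i = a ∧ j = b
    · obtain ⟨rfl, rfl⟩ := h
      simp [hab]
    · simp [hab, h]

lemma gram_symm (p : MvPolynomial (Fin 4) k) : (gram p).IsSymm := by
  ext i j
  simp only [gram, Matrix.transpose_apply, Matrix.of_apply]
  by_cases h : i = j
  · subst h; simp
  · rw [if_neg h, if_neg (Ne.symm h), add_comm]

lemma gram_quad (h2 : (2:k) ≠ 0) {M : Matrix (Fin 4) (Fin 4) k} (hM : M.IsSymm) : gram (quad M) = M := by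
  rw [← gramL_apply, quad_apply]
  simp only [map_sum, ← smul_eq_C_mul, map_smul, gramL_apply]
  ext a b
  simp only [Matrix.sum_apply, Matrix.smul_apply, gram_XX h2, smul_eq_mul]
  have : ∀ i j, M i j * (((if i = a ∧ j = b then (1:k) else 0) + (if i = b ∧ j = a then 1 else 0)) / 2) =
      (if i = a then if j = b then M i j / 2 else 0 else 0) + (if i = b then if j = a then M i j / 2 else 0 else 0) := by
    intro i j
    simp only [ite_and]; split_ifs <;> ring
  simp only [this, Finset.sum_add_distrib]
  simp
  rw [hM.apply b a, ← two_mul]; field_simp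

lemma quad_gram (h2 : (2:k) ≠ 0) {p : MvPolynomial (Fin 4) k} (hp : p.IsHomogeneous 2) : quad (gram p) = p := by
  have hp' : p ∈ homogeneousSubmodule (Fin 4) k 2 := hp
  rw [H2_span] at hp'
  have : (quad ∘ₗ gramL) p = (LinearMap.id : MvPolynomial (Fin 4) k →ₗ[k] _) p := by
    refine LinearMap.eqOn_span ?_ hp'
    rintro _ ⟨⟨i, j⟩, rfl⟩
    simp only [LinearMap.comp_apply, LinearMap.id_apply, gramL_apply, quad_apply, gram_XX h2]
    have : ∀ a b, C (((if i = a ∧ j = b then (1:k) else 0) + (if i = b ∧ j = a then 1 else 0)) / 2) * (X a * X b : MvPolynomial (Fin 4) k) =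
      (if i = a then if j = b then C (1/2) * (X a * X b) else 0 else 0) + (if i = b then if j = a then C (1/2) * (X a * X b) else 0 else 0) := by
      intro a b
      simp only [ite_and]; split_ifs <;> simp [add_div, add_mul]
    simp only [this, Finset.sum_add_distrib]
    rw [Finset.sum_comm (f := fun a b => (if i = b then if j = a then C (1/2) * (X a * X b : MvPolynomial (Fin 4) k) else 0 else 0))]
    simp
    rw [mul_comm (X j) (X i), ← two_mul, ← mul_assoc, ← map_ofNat C 2, ← C_mul, mul_inv_cancel₀ h2]; simp
  exact this

def inn (M N : Matrix (Fin 4) (Fin 4) k) : k := ∑ i, ∑ j, M i j * N i j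

def dL (g : MvPolynomial (Fin 4) k) : MvPolynomial (Fin 4) k →ₗ[k] MvPolynomial (Fin 4) k :=
  (basisMonomials (Fin 4) k).constr k fun m => monD k m g

lemma dL_mon (g : MvPolynomial (Fin 4) k) (m) : dL g (monomial m 1) = monD k m g := by
  have := (basisMonomials (Fin 4) k).constr_basis k (fun m => monD k m g) m
  rwa [coe_basisMonomials] at this

lemma diffOp_eq (f g : MvPolynomial (Fin 4) k) : diffOp f g = dL g f := by
  conv_rhs => rw [f.as_sum]
  rw [map_sum]
  refine Finset.sum_congr rfl fun m _ => ?_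
  have : monomial m (coeff m f) = coeff m f • monomial m (1:k) := by simp [smul_monomial]
  rw [this, map_smul, dL_mon]

lemma pX (i a : Fin 4) : pderiv i (X a : MvPolynomial (Fin 4) k) = C (if i = a then 1 else 0) := by
  rw [pderiv_X, Pi.single_apply]; by_cases h : i = a
  · simp [h]
  · simp [h, Ne.symm h]

lemma pXX (i j a b : Fin 4) : pderiv i (pderiv j (X a * X b : MvPolynomial (Fin 4) k)) =
    C ((if i = a ∧ j = b then (1:k) else 0) + (if i = b ∧ j = a then 1 else 0)) := by
  simp only [Derivation.leibniz, pX, map_add, smul_eq_mul, derivation_C, mul_zero, zero_add, ite_and]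
  split_ifs <;> simp

lemma monD_XX (i j a b : Fin 4) : monD k (Finsupp.single i 1 + Finsupp.single j 1) (X a * X b) =
    C ((if i = a ∧ j = b then (1:k) else 0) + (if i = b ∧ j = a then 1 else 0)) := by
  have : monD k (Finsupp.single i 1 + Finsupp.single j 1) (X a * X b) =
      pderiv i (pderiv j (X a * X b : MvPolynomial (Fin 4) k)) ∨
      monD k (Finsupp.single i 1 + Finsupp.single j 1) (X a * X b) =
      pderiv j (pderiv i (X a * X b : MvPolynomial (Fin 4) k)) := by
    fin_cases i <;> fin_cases j <;> simp [monD, pow_two, Module.End.mul_apply]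
  rcases this with h | h
  · rw [h, pXX]
  · rw [h, pXX]; congr 1; simp only [ite_and]; split_ifs <;> simp

lemma diffOp_inn (h2 : (2:k) ≠ 0) {p f : MvPolynomial (Fin 4) k} (hp : p.IsHomogeneous 2)
    (hf : f.IsHomogeneous 2) : diffOp p f = C (2 * inn (gram p) (gram f)) := by
  have key : ∀ i j, dL f (X i * X j) = C (2 * gram f i j) := by
    intro i j
    have e : (X i * X j : MvPolynomial (Fin 4) k) = monomial (Finsupp.single i 1 + Finsupp.single j 1) 1 := by
      simp [X, monomial_mul]
    rw [e, dL_mon]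
    conv_lhs => rw [← quad_gram h2 hf, quad_apply]
    simp only [map_sum, ← smul_eq_C_mul, map_smul, monD_XX]
    simp only [smul_eq_C_mul, ← C_mul]
    simp only [← map_sum]
    congr 1
    have : ∀ a b, gram f a b * (((if i = a ∧ j = b then (1:k) else 0) + (if i = b ∧ j = a then 1 else 0))) =
      (if i = a then if j = b then gram f a b else 0 else 0) + (if j = a then if i = b then gram f a b else 0 else 0) := by
      intro a b
      simp only [ite_and]; split_ifs <;> ring
    simp only [this, Finset.sum_add_distrib]
    simp
    rw [(gram_symm f).apply i j, two_mul]
  rw [diffOp_eq]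
  conv_lhs => rw [← quad_gram h2 hp, quad_apply]
  simp only [map_sum, ← smul_eq_C_mul, map_smul, key]
  simp only [smul_eq_C_mul, ← C_mul, inn, Finset.mul_sum, map_sum]
  refine Finset.sum_congr rfl fun i _ => Finset.sum_congr rfl fun j _ => ?_
  congr 1; ring

lemma mem_perp (h2 : (2:k) ≠ 0) {L : Submodule k (MvPolynomial (Fin 4) k)}
    (hL : L ≤ homogeneousSubmodule (Fin 4) k 2) {p : MvPolynomial (Fin 4) k} :
    p ∈ perpSet L ↔ p.IsHomogeneous 2 ∧ ∀ f ∈ L, inn (gram p) (gram f) = 0 := by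
  constructor
  · rintro ⟨h, h'⟩
    refine ⟨h, fun f hf => ?_⟩
    have := h' f hf
    rw [diffOp_inn h2 h (hL hf), C_eq_zero] at this
    exact (mul_eq_zero.1 this).resolve_left h2
  · rintro ⟨h, h'⟩
    refine ⟨h, fun f hf => ?_⟩
    rw [diffOp_inn h2 h (hL hf), h' f hf]; simp

lemma inn_Theta (Θ : MvPolynomial (Fin 4) k →ₗ[k] k) (M : Matrix (Fin 4) (Fin 4) k) :
    inn (Matrix.of fun i j => Θ (X i * X j)) M = Θ (quad M) := by
  rw [quad_apply, inn]
  simp only [map_sum, ← smul_eq_C_mul, map_smul, smul_eq_mul, Matrix.of_apply]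
  simp only [mul_comm]

lemma Theta_symm (Θ : MvPolynomial (Fin 4) k →ₗ[k] k) :
    (Matrix.of fun i j => Θ (X i * X j)).IsSymm := by
  ext i j; simp [mul_comm]

lemma dperp (h2 : (2:k) ≠ 0) {L : Submodule k (MvPolynomial (Fin 4) k)}
    (hL : L ≤ homogeneousSubmodule (Fin 4) k 2) {M : Matrix (Fin 4) (Fin 4) k}
    (h : ∀ p ∈ perpSet L, inn (gram p) M = 0) : quad M ∈ L := by
  by_contra hM
  obtain ⟨Θ, hΘ, hLΘ⟩ := Submodule.exists_le_ker_of_notMem hM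
  have hs := Theta_symm Θ
  set N := Matrix.of fun i j => Θ (X i * X j)
  have h1 : quad N ∈ perpSet L := by
    rw [mem_perp h2 hL]
    refine ⟨quad_homog _, fun f hf => ?_⟩
    rw [gram_quad h2 hs, inn_Theta, quad_gram h2 (hL hf)]
    exact hLΘ hf
  have := h _ h1
  rw [gram_quad h2 hs, inn_Theta] at this
  exact hΘ this

def innB : LinearMap.BilinForm k (MvPolynomial (Fin 4) k) :=
  LinearMap.mk₂ k (fun p q => inn (gram p) (gram q))
    (by intro a b c; rw [← gramL_apply (a+b), map_add]; simp [inn, gramL_apply, add_mul, Finset.sum_add_distrib])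
    (by intro a b c; rw [← gramL_apply (a•b), map_smul]; simp [inn, gramL_apply, mul_assoc, Finset.mul_sum])
    (by intro c a b; rw [← gramL_apply (a+b), map_add]; simp [inn, gramL_apply, mul_add, Finset.sum_add_distrib])
    (by intro a c b; rw [← gramL_apply (a•b), map_smul]; simp [inn, gramL_apply, mul_left_comm, Finset.mul_sum])

lemma innB_apply (p q : MvPolynomial (Fin 4) k) : innB p q = inn (gram p) (gram q) := rfl

lemma inn_comm (M N : Matrix (Fin 4) (Fin 4) k) : inn M N = inn N M := by simp [inn, mul_comm]

lemma abs_perp {V : Type} [AddCommGroup V] [Module k V] (B0 : LinearMap.BilinForm k V)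
    (hs : ∀ x y, B0 x y = B0 y x) (H L : Submodule k V) [FiniteDimensional k H] (hL : L ≤ H)
    (hnd : ∀ x ∈ H, (∀ y ∈ H, B0 x y = 0) → x = 0) {n : ℕ}
    (hn : Module.finrank k H = Module.finrank k L + n) :
    ∃ b : Fin n → V, LinearIndependent k b ∧
      ∀ p, p ∈ Submodule.span k (Set.range b) ↔ p ∈ H ∧ ∀ f ∈ L, B0 p f = 0 := by
  let B : LinearMap.BilinForm k H := B0.restrict H
  have hB : B.Nondegenerate := by
    constructor
    · intro x hx
      exact Subtype.ext (hnd x x.2 fun y hy => hx ⟨y, hy⟩)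
    · intro x hx
      exact Subtype.ext (hnd x x.2 fun y hy => (hs _ _).trans (hx ⟨y, hy⟩))
  let W : Submodule k H := L.comap H.subtype
  have hW : Module.finrank k W = Module.finrank k L :=
    (Submodule.comapSubtypeEquivOfLe hL).finrank_eq
  have h7 : Module.finrank k (B.orthogonal W) = n := by
    rw [LinearMap.BilinForm.finrank_orthogonal hB, hW, hn]; simp
  let b := Module.finBasisOfFinrankEq k _ h7
  refine ⟨fun i => ((b i : H) : V), ?_, ?_⟩
  · have := b.linearIndependent
    have := this.map' (B.orthogonal W).subtype (Submodule.ker_subtype _)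
    exact this.map' H.subtype (Submodule.ker_subtype _)
  · have e : (Set.range fun i => ((b i : H) : V)) =
      (H.subtype ∘ₗ (B.orthogonal W).subtype) '' Set.range b := by
      rw [← Set.range_comp]; rfl
    intro p
    rw [e, Submodule.span_image, b.span_eq]
    simp only [Submodule.map_top, LinearMap.mem_range]
    constructor
    · rintro ⟨⟨x, hx⟩, rfl⟩
      refine ⟨x.2, fun f hf => ?_⟩
      rw [hs]
      exact hx ⟨f, hL hf⟩ hf
    · rintro ⟨hp, h⟩
      refine ⟨⟨⟨p, hp⟩, fun f hf => ?_⟩, rfl⟩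
      have := h f hf
      rw [hs] at this
      exact this

lemma exists_perpBasis (h2 : (2:k) ≠ 0) {L : Submodule k (MvPolynomial (Fin 4) k)}
    (hL : L ≤ homogeneousSubmodule (Fin 4) k 2) (hdim : Module.finrank k L = 3) :
    ∃ q, IsPerpBasis L q := by
  have : FiniteDimensional k (homogeneousSubmodule (Fin 4) k 2) :=
    Module.Finite.iff_fg.2 (homogeneousSubmodule_fg _ _ 2)
  obtain ⟨b, hb, hb'⟩ := abs_perp (n := 7) innB (fun x y => inn_comm _ _) _ L hL (by
    intro x hx h
    have hx' : x.IsHomogeneous 2 := hx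
    rw [← quad_gram h2 hx']
    have : gram x = 0 := by
      ext i j
      have := h (X i * X j) ((isHomogeneous_X k i).mul (isHomogeneous_X k j))
      rw [innB_apply, inn] at this
      simp only [gram_XX h2] at this
      have e : ∀ a b, gram x a b * (((if i = a ∧ j = b then (1:k) else 0) + (if i = b ∧ j = a then 1 else 0))/2) =
        (if i = a then if j = b then gram x a b / 2 else 0 else 0) + (if j = a then if i = b then gram x a b / 2 else 0 else 0) := by
        intro a b
        simp only [ite_and]; split_ifs <;> ring
      simp only [e, Finset.sum_add_distrib] at this
      simp at this
      rw [(gram_symm x).apply i j, ← two_mul, mul_div_cancel₀ _ h2] at this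
      exact this
    rw [this, map_zero]) (by rw [hdim, finrank_homog]; rfl)
  refine ⟨b, hb, ?_⟩
  ext p
  rw [mem_perp h2 hL, SetLike.mem_coe, hb']; rfl
end partPA

section partPE
lemma fin2_eta {M : Type} (v : Fin 2 → M) : v = ![v 0, v 1] := by
  funext i; fin_cases i <;> rfl

lemma ker_two {P M : Type} [AddCommGroup P] [Module k P] [AddCommGroup M] [Module k M]
    (hP : Module.finrank k P = 3) (g : P →ₗ[k] M)
    (h : ∀ y y', ¬ LinearIndependent k ![g y, g y']) :
    ∃ x x', g x = 0 ∧ g x' = 0 ∧ LinearIndependent k ![x, x'] := by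
  have : FiniteDimensional k P := Module.finite_of_finrank_pos (by omega)
  have h1 := LinearMap.finrank_range_add_finrank_ker g
  have h2 : ¬ 2 ≤ Module.finrank k (LinearMap.range g) := by
    intro h2
    obtain ⟨v, hv⟩ := exists_linearIndependent_of_le_finrank h2
    have hv' := hv.map' (LinearMap.range g).subtype (Submodule.ker_subtype _)
    obtain ⟨y, hy⟩ := (v 0).2
    obtain ⟨y', hy'⟩ := (v 1).2
    apply h y y'
    rw [hy, hy']
    rw [fin2_eta (_ ∘ v)] at hv'
    exact hv'
  have h3 : 2 ≤ Module.finrank k (LinearMap.ker g) := by omega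
  obtain ⟨v, hv⟩ := exists_linearIndependent_of_le_finrank h3
  have hv' := hv.map' (LinearMap.ker g).subtype (Submodule.ker_subtype _)
  rw [fin2_eta (_ ∘ v)] at hv'
  exact ⟨v 0, v 1, (v 0).2, (v 1).2, hv'⟩

variable {L : Submodule k (MvPolynomial (Fin 4) k)}

lemma kill2 (hsec : ∀ q ∈ L, q ≠ 0 → ¬ (gram q).rank ≤ 2) {A : MvPolynomial (Fin 4) k} (hA : A ∈ L)
    {w v : Fin 4 → k} (hw : (gram A).mulVec w = 0) (hv : (gram A).mulVec v = 0)
    (hli : LinearIndependent k ![w, v]) : A = 0 := by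
  by_contra h
  exact hsec A hA h (rank_le_two_of_ker hw hv hli)

lemma killw [IsAlgClosed k] (hsec : ∀ q ∈ L, q ≠ 0 → ¬ (gram q).rank ≤ 2) {A B : MvPolynomial (Fin 4) k} (hA : A ∈ L)
    (hB : B ∈ L) {w : Fin 4 → k} (hw : w ≠ 0) (hAw : (gram A).mulVec w = 0) (hBw : (gram B).mulVec w = 0) :
    ¬ LinearIndependent k ![A, B] := by
  intro hli
  obtain ⟨α, β, hab, hr⟩ := pencil_sym (gram_symm A) (gram_symm B) hw hAw hBw
  have h0 : α • A + β • B = 0 := by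
    by_contra h
    refine hsec _ (L.add_mem (L.smul_mem α hA) (L.smul_mem β hB)) h ?_
    rw [← gramL_apply, map_add, map_smul, map_smul]
    exact hr
  have := LinearIndependent.pair_iff.1 hli α β h0
  rcases hab with h | h
  · exact h this.1
  · exact h this.2

lemma li_ne {P : Type} [AddCommGroup P] [Module k P] {x y : P} (h : LinearIndependent k ![x, y]) : x ≠ 0 :=
  h.ne_zero 0

lemma li_map {P M : Type} [AddCommGroup P] [Module k P] [AddCommGroup M] [Module k M] {x y : P} {f : P →ₗ[k] M}
    (hf : Function.Injective f) (h : LinearIndependent k ![x, y]) : LinearIndependent k ![f x, f y] := by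
  have := h.map' f (LinearMap.ker_eq_bot.2 hf)
  rw [fin2_eta (_ ∘ _)] at this
  exact this

lemma gram_zero' : gram (0 : MvPolynomial (Fin 4) k) = 0 := map_zero gramL

lemma sym_f [IsAlgClosed k] (hsec : ∀ q ∈ L, q ≠ 0 → ¬ (gram q).rank ≤ 2) {P : Type} [AddCommGroup P] [Module k P]
    (hP : Module.finrank k P = 3) {f : P →ₗ[k] MvPolynomial (Fin 4) k} {g : P →ₗ[k] (Fin 4 → k)} (hfL : ∀ x, f x ∈ L)
    (hfg : ∀ x y, (gram (f x)).mulVec (g y) = (gram (f y)).mulVec (g x))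
    (hg : Function.Injective g) (hf : f ≠ 0) : Function.Injective f := by
  rw [injective_iff_map_eq_zero]
  by_contra! hx
  obtain ⟨x, hx, hx0⟩ := hx
  have hk : ∀ x, f x = 0 → ∀ y, (gram (f y)).mulVec (g x) = 0 := by
    intro x hx y
    rw [hfg, hx, gram_zero', Matrix.zero_mulVec]
  obtain ⟨a, b, ha, hb, hab⟩ := ker_two hP f fun y y' => killw hsec (hfL y) (hfL y')
    (fun h => hx0 (hg (h.trans (map_zero g).symm))) (hk x hx y) (hk x hx y')
  apply hf
  ext1 y
  exact kill2 hsec (hfL y) (hk a ha y) (hk b hb y) (li_map hg hab)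

lemma sym_g [IsAlgClosed k] (hsec : ∀ q ∈ L, q ≠ 0 → ¬ (gram q).rank ≤ 2) {P : Type} [AddCommGroup P] [Module k P]
    (hP : Module.finrank k P = 3) {f : P →ₗ[k] MvPolynomial (Fin 4) k} {g : P →ₗ[k] (Fin 4 → k)} (hfL : ∀ x, f x ∈ L)
    (hfg : ∀ x y, (gram (f x)).mulVec (g y) = (gram (f y)).mulVec (g x))
    (hf : Function.Injective f) (hg : g ≠ 0) : Function.Injective g := by
  rw [injective_iff_map_eq_zero]
  by_contra! hx
  obtain ⟨x, hx, hx0⟩ := hx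
  have hk : ∀ x, g x = 0 → ∀ y, (gram (f x)).mulVec (g y) = 0 := by
    intro x hx y
    rw [hfg, hx, Matrix.mulVec_zero]
  obtain ⟨a, b, ha, hb, hab⟩ := ker_two hP g fun y y' hli => hx0 (hf ((kill2 hsec (hfL x) (hk x hx y) (hk x hx y') hli).trans (map_zero f).symm))
  apply hg
  ext1 y
  by_contra hy
  exact killw hsec (hfL a) (hfL b) hy (hk a ha y) (hk b hb y) (li_map hf hab)
end partPE

section partPE1
def vl : (Fin 4 → k) →ₗ[k] MvPolynomial (Fin 4) k where
  toFun w := ∑ i, C (w i) * X i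
  map_add' a b := by simp [add_mul, Finset.sum_add_distrib]
  map_smul' a b := by simp [Finset.smul_sum, smul_eq_C_mul, mul_assoc]

lemma vl_apply (w : Fin 4 → k) : vl w = ∑ i, C (w i) * X i := rfl

lemma vl_homog (w : Fin 4 → k) : (vl w).IsHomogeneous 1 := by
  rw [vl_apply]
  exact IsHomogeneous.sum _ _ _ fun i _ => (isHomogeneous_X k i).C_mul _

lemma eval_vl (w l : Fin 4 → k) : eval l (vl w) = w ⬝ᵥ l := by
  simp [vl_apply, dotProduct]

def fT (Θ : MvPolynomial (Fin 4) k →ₗ[k] k) : (Fin 4 → k) →ₗ[k] MvPolynomial (Fin 4) k where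
  toFun w := quad ((1/2 : k) • Matrix.of fun j m => Θ (vl w * (X j * X m)))
  map_add' a b := by
    rw [← map_add, ← smul_add]; congr 2; ext j m; simp [add_mul]
  map_smul' a b := by
    rw [RingHom.id_apply, ← map_smul quad]; congr 1; ext j m; simp; ring

lemma fT_apply (Θ : MvPolynomial (Fin 4) k →ₗ[k] k) (w : Fin 4 → k) :
  fT Θ w = quad ((1/2 : k) • Matrix.of fun j m => Θ (vl w * (X j * X m))) := rfl

lemma gram_fT (h2 : (2:k) ≠ 0) (Θ : MvPolynomial (Fin 4) k →ₗ[k] k) (w : Fin 4 → k) :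
    gram (fT Θ w) = (1/2 : k) • Matrix.of fun j m => Θ (vl w * (X j * X m)) := by
  rw [fT_apply, gram_quad h2]
  ext i j
  simp [mul_comm (X i) (X j)]

lemma gram_fT_mulVec (h2 : (2:k) ≠ 0) (Θ : MvPolynomial (Fin 4) k →ₗ[k] k) (w w' : Fin 4 → k) (j : Fin 4) :
    (gram (fT Θ w)).mulVec w' j = (1/2 : k) * Θ (vl w * (vl w' * X j)) := by
  rw [gram_fT h2]
  simp only [Matrix.mulVec, dotProduct, Matrix.smul_apply, Matrix.of_apply, smul_eq_mul]
  rw [vl_apply w', Finset.sum_mul, Finset.mul_sum, map_sum, Finset.mul_sum]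
  refine Finset.sum_congr rfl fun m _ => ?_
  have : vl w * (C (w' m) * X m * X j) = w' m • (vl w * (X j * X m)) := by
    rw [smul_eq_C_mul]; ring
  rw [this, map_smul, smul_eq_mul]; ring

lemma gram_fT_symm (h2 : (2:k) ≠ 0) (Θ : MvPolynomial (Fin 4) k →ₗ[k] k) (w w' : Fin 4 → k) :
    (gram (fT Θ w)).mulVec w' = (gram (fT Θ w')).mulVec w := by
  funext j
  rw [gram_fT_mulVec h2, gram_fT_mulVec h2, mul_left_comm]

lemma fT_mem (h2 : (2:k) ≠ 0) {L : Submodule k (MvPolynomial (Fin 4) k)}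
    (hL : L ≤ homogeneousSubmodule (Fin 4) k 2) (Θ : MvPolynomial (Fin 4) k →ₗ[k] k) (w : Fin 4 → k)
    (h : ∀ p ∈ perpSet L, Θ (vl w * p) = 0) : fT Θ w ∈ L := by
  refine dperp h2 hL fun p hp => ?_
  have := inn_Theta (Θ ∘ₗ LinearMap.mulLeft k (vl w)) (gram p)
  rw [quad_gram h2 hp.1, LinearMap.comp_apply, LinearMap.mulLeft_apply, h p hp] at this
  rw [inn_comm]
  simp only [inn, Matrix.smul_apply, smul_eq_mul, mul_assoc, ← Finset.mul_sum, Matrix.of_apply] at this ⊢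
  simp only [LinearMap.comp_apply, LinearMap.mulLeft_apply] at this
  rw [this, mul_zero]

lemma dirDeriv_mul (v : Fin 4 → k) (p q : MvPolynomial (Fin 4) k) :
    dirDeriv v (p * q) = dirDeriv v p * q + p * dirDeriv v q := by
  simp only [dirDeriv, Derivation.leibniz, Finset.sum_mul, Finset.mul_sum, ← Finset.sum_add_distrib]
  refine Finset.sum_congr rfl fun i _ => ?_
  simp only [smul_eq_mul, smul_add, smul_eq_C_mul]; ring

def dD (v : Fin 4 → k) : MvPolynomial (Fin 4) k →ₗ[k] MvPolynomial (Fin 4) k :=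
  ∑ i, v i • (pderiv i).toLinearMap

lemma dD_apply (v : Fin 4 → k) (p : MvPolynomial (Fin 4) k) : dD v p = dirDeriv v p := by
  simp [dD, dirDeriv]

lemma dirDeriv_X (v : Fin 4 → k) (j : Fin 4) : dirDeriv v (X j : MvPolynomial (Fin 4) k) = C (v j) := by
  simp only [dirDeriv, pX, smul_eq_C_mul]
  rw [Finset.sum_eq_single j]
  · simp
  · intro i _ hi; simp [hi]
  · simp

lemma dirDeriv_C (v : Fin 4 → k) (c : k) : dirDeriv v (C c : MvPolynomial (Fin 4) k) = 0 := by
  simp [dirDeriv]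

lemma dirDeriv_quad (v : Fin 4 → k) {M : Matrix (Fin 4) (Fin 4) k} (hM : M.IsSymm) :
    dirDeriv v (quad M) = 2 * ∑ j, C (M.mulVec v j) * X j := by
  rw [← dD_apply, quad_apply]
  simp only [map_sum, dD_apply, dirDeriv_mul, dirDeriv_X, dirDeriv_C, zero_mul, zero_add, mul_add,
    Finset.sum_add_distrib]
  rw [Finset.sum_comm, ← Finset.sum_add_distrib, Finset.mul_sum]
  refine Finset.sum_congr rfl fun j _ => ?_
  simp only [Matrix.mulVec, dotProduct, map_sum, C_mul, Finset.sum_mul, Finset.mul_sum]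
  rw [← Finset.sum_add_distrib]
  refine Finset.sum_congr rfl fun i _ => ?_
  rw [hM.apply j i]; ring

def cubF (Θ : MvPolynomial (Fin 4) k →ₗ[k] k) : MvPolynomial (Fin 4) k :=
  C (1/3) * ∑ i, X i * fT Θ (Pi.single i 1)

lemma vl_single (i : Fin 4) : vl (Pi.single i 1 : Fin 4 → k) = X i := by
  rw [vl_apply, Finset.sum_eq_single i]
  · simp
  · intro j _ hj; simp [hj]
  · simp

lemma cubF_homog (Θ : MvPolynomial (Fin 4) k →ₗ[k] k) : (cubF Θ).IsHomogeneous 3 := by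
  refine IsHomogeneous.C_mul ?_ _
  exact IsHomogeneous.sum _ _ _ fun i _ => (isHomogeneous_X k i).mul (quad_homog _)

lemma dirDeriv_cubF (h2 : (2:k) ≠ 0) (h3 : (3:k) ≠ 0) (Θ : MvPolynomial (Fin 4) k →ₗ[k] k) (v : Fin 4 → k) :
    dirDeriv v (cubF Θ) = fT Θ v := by
  have e1 : ∀ w, fT Θ w = quad (gram (fT Θ w)) := fun w => (quad_gram h2 (quad_homog _)).symm
  have e2 : ∀ i, dirDeriv v (fT Θ (Pi.single i 1)) = 2 * ∑ j, C (gram (fT Θ v) i j) * X j := by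
    intro i
    conv_lhs => rw [e1]
    rw [dirDeriv_quad v (gram_symm _), gram_fT_symm h2]
    congr 1
    refine Finset.sum_congr rfl fun j _ => ?_
    rw [Matrix.mulVec_single_one, (gram_symm (fT Θ v)).apply]; rfl
  have e3 : ∑ i, C (v i) * fT Θ (Pi.single i 1) = fT Θ v := by
    conv_rhs => rw [pi_eq_sum_univ' v]
    simp only [map_sum, map_smul, smul_eq_C_mul]
  rw [cubF, ← smul_eq_C_mul, ← dD_apply, map_smul, map_sum]
  simp only [dD_apply, dirDeriv_mul, dirDeriv_X, e2, Finset.sum_add_distrib, e3]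
  have e4 : ∑ i, X i * (2 * ∑ j, C (gram (fT Θ v) i j) * X j) = 2 * fT Θ v := by
    conv_rhs => rw [e1, quad_apply]
    simp only [Finset.mul_sum]
    refine Finset.sum_congr rfl fun j _ => Finset.sum_congr rfl fun i _ => ?_
    ring
  rw [e4, smul_eq_C_mul]
  have : (1:MvPolynomial (Fin 4) k) = C (1/3) * 3 := by
    rw [← map_ofNat C 3, ← C_mul]; simp [h3]
  linear_combination (- fT Θ v) * this
end partPE1

section partPE2
def IsDer (L : Submodule k (MvPolynomial (Fin 4) k)) : Prop :=
  ∃ (F : MvPolynomial (Fin 4) k) (v₁ v₂ v₃ : Fin 4 → k), F.IsHomogeneous 3 ∧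
        L = Submodule.span k {dirDeriv v₁ F, dirDeriv v₂ F, dirDeriv v₃ F}

def Wl (l : Fin 4 → k) : Submodule k (Fin 4 → k) := LinearMap.ker (dotProductBilin k k l)

lemma mem_Wl {l w : Fin 4 → k} : w ∈ Wl l ↔ l ⬝ᵥ w = 0 := Iff.rfl

lemma finrank_Wl {l : Fin 4 → k} (hl : l ≠ 0) : Module.finrank k (Wl l) = 3 := by
  let φ : (Fin 4 → k) →ₗ[k] k := dotProductBilin k k l
  have hφ : ∀ v, φ v = l ⬝ᵥ v := fun v => rfl
  have hφ0 : φ ≠ 0 := by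
    intro h
    apply hl
    funext i
    have := congrArg (fun f => f (Pi.single i 1)) h
    simpa [hφ] using this
  have := LinearMap.finrank_range_add_finrank_ker φ
  rw [LinearMap.range_eq_top.2 (LinearMap.surjective hφ0)] at this
  simp at this
  change Module.finrank k (LinearMap.ker φ) = 3
  omega

lemma H3_span : homogeneousSubmodule (Fin 4) k 3 =
    Submodule.span k (Set.range fun p : Fin 4 × Fin 4 × Fin 4 => (X p.1 * (X p.2.1 * X p.2.2) : MvPolynomial (Fin 4) k)) := by
  rw [← homogeneousSubmodule_one_pow, pow_succ', homogeneousSubmodule_one_pow, H2_span,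
    homogeneousSubmodule_one_eq_span_X, Submodule.span_mul_span]
  congr 1
  ext p
  simp only [Set.mem_mul, Set.mem_range]
  constructor
  · rintro ⟨_, ⟨i, rfl⟩, _, ⟨j, rfl⟩, rfl⟩; exact ⟨(i, j), rfl⟩
  · rintro ⟨⟨i, j⟩, rfl⟩; exact ⟨_, ⟨i, rfl⟩, _, ⟨j, rfl⟩, rfl⟩

lemma exists_dot_one {l : Fin 4 → k} (hl : l ≠ 0) : ∃ x : Fin 4 → k, l ⬝ᵥ x = 1 := by
  obtain ⟨i, hi⟩ := Function.ne_iff.1 hl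
  refine ⟨Pi.single i (l i)⁻¹, ?_⟩
  simp [mul_inv_cancel₀ hi]

lemma fiber [IsAlgClosed k] (h2 : (2:k) ≠ 0) (h3 : (3:k) ≠ 0) {L : Submodule k (MvPolynomial (Fin 4) k)}
    (hL : L ≤ homogeneousSubmodule (Fin 4) k 2) (hdim : Module.finrank k L = 3)
    (hsec : ∀ q ∈ L, q ≠ 0 → ¬ (gram q).rank ≤ 2) (hno : ¬ IsDer L) {l : Fin 4 → k} (hl : l ≠ 0)
    (Θ : MvPolynomial (Fin 4) k →ₗ[k] k) (h : ∀ w, l ⬝ᵥ w = 0 → ∀ p ∈ perpSet L, Θ (vl w * p) = 0) :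
    ∃ c, ∀ p : MvPolynomial (Fin 4) k, p.IsHomogeneous 3 → Θ p = c * eval l p := by
  have : FiniteDimensional k L := Module.finite_of_finrank_pos (by omega)
  let f : Wl l →ₗ[k] MvPolynomial (Fin 4) k := fT Θ ∘ₗ (Wl l).subtype
  have hfL : ∀ x, f x ∈ L := fun x => fT_mem h2 hL Θ _ (h x x.2)
  have hf0 : f = 0 := by
    by_contra hf
    have hinj := sym_f hsec (finrank_Wl hl) (f := f) (g := (Wl l).subtype) hfL
      (fun x y => gram_fT_symm h2 Θ x y) Subtype.val_injective hf
    let b := Module.finBasisOfFinrankEq k _ (finrank_Wl hl)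
    have hli := b.linearIndependent.map' f (LinearMap.ker_eq_bot.2 hinj)
    apply hno
    refine ⟨cubF Θ, b 0, b 1, b 2, cubF_homog Θ, ?_⟩
    simp only [dirDeriv_cubF h2 h3]
    symm
    apply Submodule.eq_of_le_of_finrank_eq
    · rw [Submodule.span_le]
      rintro _ (rfl | rfl | rfl)
      · exact hfL (b 0)
      · exact hfL (b 1)
      · exact hfL (b 2)
    · have e : ({(fT Θ) (b 0), (fT Θ) (b 1), (fT Θ) (b 2)} : Set (MvPolynomial (Fin 4) k)) = Set.range (f ∘ b) := by
        ext p
        simp only [Set.mem_insert_iff, Set.mem_singleton_iff, Set.mem_range, Fin.exists_fin_succ]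
        simp [f, eq_comm]
      rw [e, finrank_span_eq_card hli, hdim]; rfl
  have key : ∀ w, l ⬝ᵥ w = 0 → ∀ j m, Θ (vl w * (X j * X m)) = 0 := by
    intro w hw j m
    have h0 : fT Θ w = 0 := LinearMap.congr_fun hf0 ⟨w, hw⟩
    have h1 := gram_fT h2 Θ w
    rw [h0, gram_zero'] at h1
    have h4 := congrFun (congrFun h1 j) m
    simp only [Matrix.zero_apply, Matrix.smul_apply, Matrix.of_apply, smul_eq_mul] at h4
    exact (mul_eq_zero.1 h4.symm).resolve_left (by simp [h2])
  obtain ⟨x, hx⟩ := exists_dot_one hl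
  have step : ∀ i (p : MvPolynomial (Fin 4) k), p.IsHomogeneous 2 → Θ (X i * p) = l i * Θ (vl x * p) := by
    intro i p hp
    have hp' : p ∈ homogeneousSubmodule (Fin 4) k 2 := hp
    rw [H2_span] at hp'
    have hw : l ⬝ᵥ (Pi.single i 1 - l i • x) = 0 := by simp [dotProduct_sub, hx]
    have : (Θ ∘ₗ LinearMap.mulLeft k (vl (Pi.single i 1 - l i • x))) p = (0 : MvPolynomial (Fin 4) k →ₗ[k] k) p := by
      refine LinearMap.eqOn_span ?_ hp'
      rintro _ ⟨⟨a, b⟩, rfl⟩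
      exact key _ hw a b
    rw [LinearMap.comp_apply, LinearMap.mulLeft_apply, map_sub, map_smul, vl_single, sub_mul, map_sub,
      smul_mul_assoc, map_smul, smul_eq_mul] at this
    exact sub_eq_zero.1 this
  refine ⟨Θ (vl x * (vl x * vl x)), fun p hp => ?_⟩
  have hp' : p ∈ homogeneousSubmodule (Fin 4) k 3 := hp
  rw [H3_span] at hp'
  have : Θ p = (Θ (vl x * (vl x * vl x)) • (aeval l).toLinearMap) p := by
    refine LinearMap.eqOn_span ?_ hp'
    rintro _ ⟨⟨a, b, c⟩, rfl⟩
    simp only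
    rw [step a _ ((isHomogeneous_X k b).mul (isHomogeneous_X k c)), mul_left_comm,
      step b _ ((vl_homog x).mul (isHomogeneous_X k c)),
      show vl x * (vl x * X c) = X c * (vl x * vl x) by ring, step c _ ((vl_homog x).mul (vl_homog x))]
    simp; ring
  rw [this]; simp [aeval_eq_eval]
end partPE2

section partPE3
def Psi (q : Fin 7 → MvPolynomial (Fin 4) k) : (Fin 7 → Fin 4 → k) →ₗ[k] MvPolynomial (Fin 4) k :=
  ∑ j, LinearMap.mulLeft k (q j) ∘ₗ vl ∘ₗ LinearMap.proj j

lemma Psi_apply (q : Fin 7 → MvPolynomial (Fin 4) k) (u) : Psi q u = ∑ j, q j * vl (u j) := by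
  simp [Psi]

lemma eval_quad (M : Matrix (Fin 4) (Fin 4) k) (l : Fin 4 → k) :
    eval l (quad M) = ∑ i, ∑ j, M i j * (l i * l j) := by
  simp [quad_apply]

lemma inn_vec (h2 : (2:k) ≠ 0) {p : MvPolynomial (Fin 4) k} (hp : p.IsHomogeneous 2) (l : Fin 4 → k) :
    inn (gram p) (Matrix.vecMulVec l l) = eval l p := by
  conv_rhs => rw [← quad_gram h2 hp, eval_quad]
  rfl

lemma perp_rep {L : Submodule k (MvPolynomial (Fin 4) k)} {q} (hq : IsPerpBasis L q) {p} (hp : p ∈ perpSet L) :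
    ∃ c : Fin 7 → k, ∑ j, c j • q j = p := by
  rw [← hq.2, SetLike.mem_coe] at hp
  exact (Submodule.mem_span_range_iff_exists_fun k).1 hp

lemma perp_q {L : Submodule k (MvPolynomial (Fin 4) k)} {q} (hq : IsPerpBasis L q) (j) : q j ∈ perpSet L := by
  rw [← hq.2]; exact Submodule.subset_span ⟨j, rfl⟩

lemma base_free (h2 : (2:k) ≠ 0) {L : Submodule k (MvPolynomial (Fin 4) k)}
    (hL : L ≤ homogeneousSubmodule (Fin 4) k 2)
    (hsec : ∀ q ∈ L, q ≠ 0 → ¬ (gram q).rank ≤ 2) {q} (hq : IsPerpBasis L q) {l : Fin 4 → k} (hl : l ≠ 0) :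
    ∃ j, eval l (q j) ≠ 0 := by
  by_contra! h
  have hs : (Matrix.vecMulVec l l).IsSymm := by
    ext i j; simp [Matrix.vecMulVec_apply, mul_comm]
  have hm : quad (Matrix.vecMulVec l l) ∈ L := by
    refine dperp h2 hL fun p hp => ?_
    rw [inn_vec h2 hp.1]
    obtain ⟨c, rfl⟩ := perp_rep hq hp
    simp [h, smul_eval]
  refine hsec _ hm ?_ ?_
  · intro h0
    have := gram_quad h2 hs
    rw [h0, gram_zero'] at this
    obtain ⟨i, hi⟩ := Function.ne_iff.1 hl
    have := congrFun (congrFun this i) i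
    simp [Matrix.vecMulVec_apply] at this
    exact hi this
  · rw [gram_quad h2 hs]
    exact (Matrix.rank_vecMulVec_le l l).trans (by norm_num)

lemma mem_map_Psi [IsAlgClosed k] (h2 : (2:k) ≠ 0) (h3 : (3:k) ≠ 0) {L : Submodule k (MvPolynomial (Fin 4) k)}
    (hL : L ≤ homogeneousSubmodule (Fin 4) k 2) (hdim : Module.finrank k L = 3)
    (hsec : ∀ q ∈ L, q ≠ 0 → ¬ (gram q).rank ≤ 2) (hno : ¬ IsDer L) {q} (hq : IsPerpBasis L q)
    {l : Fin 4 → k} (hl : l ≠ 0) {p : MvPolynomial (Fin 4) k} (hp : p.IsHomogeneous 3) (hpl : eval l p = 0) :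
    p ∈ (Submodule.pi Set.univ fun _ => Wl l).map (Psi q) := by
  by_contra hM
  obtain ⟨Θ, hΘ, hk⟩ := Submodule.exists_le_ker_of_notMem hM
  obtain ⟨c, hc⟩ := fiber h2 h3 hL hdim hsec hno hl Θ (by
    intro w hw p hp
    obtain ⟨c, rfl⟩ := perp_rep hq hp
    refine hk ⟨fun j => c j • w, ?_, ?_⟩
    · intro j _
      exact (Wl l).smul_mem _ hw
    · rw [Psi_apply, Finset.mul_sum]
      refine Finset.sum_congr rfl fun j _ => ?_
      rw [map_smul, mul_smul_comm, mul_smul_comm, mul_comm])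
  apply hΘ
  rw [hc p hp, hpl, mul_zero]

lemma H3_le [IsAlgClosed k] (h2 : (2:k) ≠ 0) (h3 : (3:k) ≠ 0) {L : Submodule k (MvPolynomial (Fin 4) k)}
    (hL : L ≤ homogeneousSubmodule (Fin 4) k 2) (hdim : Module.finrank k L = 3)
    (hsec : ∀ q ∈ L, q ≠ 0 → ¬ (gram q).rank ≤ 2) (hno : ¬ IsDer L) {q} (hq : IsPerpBasis L q) :
    homogeneousSubmodule (Fin 4) k 3 ≤ Submodule.span k (Set.range q) * homogeneousSubmodule (Fin 4) k 1 := by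
  have hr : LinearMap.range (Psi q) ≤ Submodule.span k (Set.range q) * homogeneousSubmodule (Fin 4) k 1 := by
    rintro _ ⟨u, rfl⟩
    rw [Psi_apply]
    exact Submodule.sum_mem _ fun j _ => Submodule.mul_mem_mul (Submodule.subset_span ⟨j, rfl⟩) (vl_homog _)
  refine le_trans ?_ hr
  -- split p into a part vanishing at e0 and a multiple of X 0 ^ 3, which vanishes at e1
  intro p hp
  have e0 : (Pi.single 0 1 : Fin 4 → k) ≠ 0 := by simp
  have e1 : (Pi.single 1 1 : Fin 4 → k) ≠ 0 := by simp
  have hX : (X 0 ^ 3 : MvPolynomial (Fin 4) k).IsHomogeneous 3 := by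
    have := (isHomogeneous_X k (0 : Fin 4)).pow 3
    simpa using this
  have hle : ∀ l : Fin 4 → k, (Submodule.pi Set.univ fun _ => Wl l).map (Psi q) ≤ LinearMap.range (Psi q) :=
    fun l => LinearMap.map_le_range
  set a := eval (Pi.single 0 1) p with ha
  have h1 := hle _ (mem_map_Psi h2 h3 hL hdim hsec hno hq e1 hX (by simp))
  have h4 := hle _ (mem_map_Psi h2 h3 hL hdim hsec hno hq e0 (p := p - C a * X 0 ^ 3)
    (IsHomogeneous.sub hp (hX.C_mul _)) (by simp [ha]))
  have := Submodule.add_mem _ h4 (Submodule.smul_mem _ a h1)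
  rwa [smul_eq_C_mul, sub_add_cancel] at this

lemma H6_le [IsAlgClosed k] (h2 : (2:k) ≠ 0) (h3 : (3:k) ≠ 0) {L : Submodule k (MvPolynomial (Fin 4) k)}
    (hL : L ≤ homogeneousSubmodule (Fin 4) k 2) (hdim : Module.finrank k L = 3)
    (hsec : ∀ q ∈ L, q ≠ 0 → ¬ (gram q).rank ≤ 2) (hno : ¬ IsDer L) {q} (hq : IsPerpBasis L q) :
    homogeneousSubmodule (Fin 4) k 6 ≤ (Submodule.span k (Set.range q)) ^ 3 := by
  have hcube : ∀ s : MvPolynomial (Fin 4) k, s.IsHomogeneous 2 → ∀ j j', s * q j * q j' ∈ (Submodule.span k (Set.range q)) ^ 3 := by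
    intro s hs j j'
    let U := LinearMap.ker (Psi q)
    let b := Module.finBasis k U
    refine cube_mem (u := fun a => (b a : Fin 7 → Fin 4 → k)) h2 (fun j => (perp_q hq j).1) ?_ (fun l hl => base_free h2 hL hsec hq hl) ?_ hs j j'
    · intro a
      have := (b a).2
      rw [LinearMap.mem_ker, Psi_apply] at this
      exact this
    · intro l hl c hc
      obtain ⟨x0, hx0⟩ := exists_dot_one hl
      obtain ⟨u', hu', hu⟩ := mem_map_Psi h2 h3 hL hdim hsec hno hq hl (p := (∑ j, c j • q j) * vl x0)
        (by
          refine IsHomogeneous.mul (m := 2) (n := 1) ?_ (vl_homog _)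
          exact IsHomogeneous.sum _ _ _ fun j _ => by rw [smul_eq_C_mul]; exact ((perp_q hq j).1).C_mul _)
        (by rw [map_mul, map_sum]; simp only [smul_eval]; rw [hc, zero_mul])
      let u : U := ⟨fun j => c j • x0 - u' j, by
        rw [LinearMap.mem_ker, Psi_apply]
        rw [Psi_apply] at hu
        simp only [map_sub, mul_sub, Finset.sum_sub_distrib, hu, map_smul, Finset.sum_mul, mul_smul_comm, smul_mul_assoc]
        simp⟩
      refine ⟨b.repr u, fun j => ?_⟩
      have h5 := b.sum_repr u
      have h6 : ∑ a, b.repr u a * (b a : Fin 7 → Fin 4 → k) j ⬝ᵥ l = (u : Fin 7 → Fin 4 → k) j ⬝ᵥ l := by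
        have h8 := congrArg (fun z : U => (z : Fin 7 → Fin 4 → k) j ⬝ᵥ l) h5
        simp only [Submodule.coe_sum, Submodule.coe_smul, Finset.sum_apply, Pi.smul_apply, sum_dotProduct,
          smul_dotProduct, smul_eq_mul] at h8
        exact h8
      have h7 : (u : Fin 7 → Fin 4 → k) j ⬝ᵥ l = c j := by
        have := hu' j (Set.mem_univ j)
        rw [SetLike.mem_coe, mem_Wl] at this
        change (c j • x0 - u' j) ⬝ᵥ l = c j
        rw [dotProduct_comm, dotProduct_sub, this, dotProduct_smul, hx0]; simp
      rw [← h7, ← h6]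
      refine Finset.sum_congr rfl fun a _ => ?_
      rw [mul_comm]; rfl
  have hQ := H3_le h2 h3 hL hdim hsec hno hq
  set Q := Submodule.span k (Set.range q) with hQd
  have e6 : homogeneousSubmodule (Fin 4) k 6 = homogeneousSubmodule (Fin 4) k 3 * homogeneousSubmodule (Fin 4) k 3 := by
    rw [← homogeneousSubmodule_one_pow k 6, ← homogeneousSubmodule_one_pow k 3, ← pow_add]
  have e2 : homogeneousSubmodule (Fin 4) k 1 * homogeneousSubmodule (Fin 4) k 1 = homogeneousSubmodule (Fin 4) k 2 := by
    rw [← homogeneousSubmodule_one_pow k 2, pow_two]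
  rw [e6]
  refine (mul_le_mul' hQ hQ).trans ?_
  rw [mul_mul_mul_comm, e2, mul_comm, Submodule.mul_le]
  intro s hs n hn
  have : Q * Q ≤ (Q ^ 3).comap (LinearMap.mulLeft k s) := by
    rw [hQd, Submodule.span_mul_span, Submodule.span_le]
    rintro _ ⟨_, ⟨j, rfl⟩, _, ⟨j', rfl⟩, rfl⟩
    have := hcube s hs j j'
    simp only [Submodule.comap_coe, Set.mem_preimage, LinearMap.mulLeft_apply, SetLike.mem_coe]
    rwa [← mul_assoc]
  exact this hn

lemma cubicRel_bot [IsAlgClosed k] (h2 : (2:k) ≠ 0) (h3 : (3:k) ≠ 0) {L : Submodule k (MvPolynomial (Fin 4) k)}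
    (hL : L ≤ homogeneousSubmodule (Fin 4) k 2) (hdim : Module.finrank k L = 3)
    (hsec : ∀ q ∈ L, q ≠ 0 → ¬ (gram q).rank ≤ 2) (hno : ¬ IsDer L) {q} (hq : IsPerpBasis L q) :
    cubicRelations q = ⊥ := by
  have h6 := H6_le h2 h3 hL hdim hsec hno hq
  have hQ : Submodule.span k (Set.range q) = (homogeneousSubmodule (Fin 7) k 1).map (aeval q).toLinearMap := by
    rw [homogeneousSubmodule_one_eq_span_X, ← Submodule.span_image, ← Set.range_comp]
    congr 2; funext j; simp
  rw [hQ, ← Submodule.map_pow, homogeneousSubmodule_one_pow] at h6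
  have : FiniteDimensional k (homogeneousSubmodule (Fin 7) k 3) :=
    Module.Finite.iff_fg.2 (homogeneousSubmodule_fg _ _ 3)
  let f := (aeval q).toLinearMap.domRestrict (homogeneousSubmodule (Fin 7) k 3)
  have hr : LinearMap.range f = (homogeneousSubmodule (Fin 7) k 3).map (aeval q).toLinearMap :=
    LinearMap.range_domRestrict _ _
  have h7 := LinearMap.finrank_range_add_finrank_ker f
  have h8 : Module.finrank k (homogeneousSubmodule (Fin 4) k 6) ≤ Module.finrank k (LinearMap.range f) := by
    rw [hr]; exact Submodule.finrank_mono h6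
  rw [finrank_homog] at h7 h8
  have h9 : Module.finrank k (LinearMap.ker f) = 0 := by
    norm_num [Nat.choose] at h7 h8
    omega
  rw [Submodule.finrank_eq_zero] at h9
  rw [Submodule.eq_bot_iff]
  rintro p ⟨hp, hp'⟩
  have : (⟨p, hp⟩ : homogeneousSubmodule (Fin 7) k 3) ∈ LinearMap.ker f := hp'
  rw [h9, Submodule.mem_bot] at this
  exact congrArg Subtype.val this
end partPE3

section partPF1
lemma skew_ker (h2 : (2:k) ≠ 0) {V : Type} [AddCommGroup V] [Module k V] [FiniteDimensional k V]
    (B : LinearMap.BilinForm k V) (hs : ∀ x y, B x y = - B y x) (hV : Even (Module.finrank k V))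
    {x0 : V} (hx0 : x0 ≠ 0) (h0 : ∀ y, B x0 y = 0) :
    ∃ x1, LinearIndependent k ![x0, x1] ∧ ∀ y, B x1 y = 0 := by
  obtain ⟨W, hW⟩ := Submodule.exists_isCompl (Submodule.span k {x0})
  have hd := Submodule.finrank_add_eq_of_isCompl hW
  rw [finrank_span_singleton hx0] at hd
  let c := Module.finBasis k W
  let G : Matrix (Fin (Module.finrank k W)) (Fin (Module.finrank k W)) k := Matrix.of fun i j => B (c i) (c j)
  have hG : G.transpose = -G := by
    ext i j; exact hs _ _
  have hodd : Odd (Module.finrank k W) := by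
    rw [← hd, Nat.even_iff] at hV
    rw [Nat.odd_iff]; omega
  have hdet : G.det = 0 := by
    have h1 := Matrix.det_transpose G
    rw [hG, Matrix.det_neg, Fintype.card_fin, hodd.neg_one_pow] at h1
    have : 2 * G.det = 0 := by linear_combination -h1
    exact (mul_eq_zero.1 this).resolve_left h2
  obtain ⟨v, hv, hGv⟩ := Matrix.exists_mulVec_eq_zero_iff.2 hdet
  let w : W := ∑ j, v j • c j
  have hw : w ≠ 0 := by
    intro h
    apply hv
    have := Fintype.linearIndependent_iff.1 c.linearIndependent v h
    funext i; exact this i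
  have hw' : (w : V) ≠ 0 := fun h => hw (Subtype.ext h)
  have hB : ∀ i, B (c i) w = 0 := by
    intro i
    have := congrFun hGv i
    simp only [Matrix.mulVec, dotProduct, G, Matrix.of_apply, Pi.zero_apply] at this
    simp only [w, Submodule.coe_sum, Submodule.coe_smul, map_sum, map_smul, smul_eq_mul]
    rw [← this]
    exact Finset.sum_congr rfl fun j _ => mul_comm _ _
  have hB' : ∀ y ∈ W, B y w = 0 := by
    intro y hy
    have h1 := c.sum_repr ⟨y, hy⟩
    have h3 := congrArg (fun z : W => B (z : V) w) h1
    simp only [Submodule.coe_sum, Submodule.coe_smul, map_sum, map_smul, LinearMap.sum_apply, LinearMap.smul_apply, hB] at h3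
    rw [← h3]; simp
  refine ⟨w, ?_, fun y => ?_⟩
  · rw [LinearIndependent.pair_iff' hx0]
    intro a ha
    apply hw'
    have h1 : (w : V) ∈ Submodule.span k {x0} := by
      rw [← ha]; exact Submodule.smul_mem _ _ (Submodule.mem_span_singleton_self _)
    have := hW.disjoint.le_bot ⟨h1, w.2⟩
    exact this
  · rw [hs]
    have : y ∈ Submodule.span k {x0} ⊔ W := by rw [hW.sup_eq_top]; trivial
    obtain ⟨a, ha, b, hb, rfl⟩ := Submodule.mem_sup.1 this
    obtain ⟨t, rfl⟩ := Submodule.mem_span_singleton.1 ha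
    simp [h0, hB' b hb]

lemma quart_root [IsAlgClosed k] (a : Fin 5 → k) (h : a 1 ≠ 0 ∨ a 2 ≠ 0 ∨ a 3 ≠ 0 ∨ a 4 ≠ 0) :
    ∃ r, a 0 + a 1 * r + a 2 * r ^ 2 + a 3 * r ^ 3 + a 4 * r ^ 4 = 0 := by
  let p : Polynomial k := Polynomial.C (a 0) + Polynomial.C (a 1) * Polynomial.X + Polynomial.C (a 2) * Polynomial.X ^ 2
    + Polynomial.C (a 3) * Polynomial.X ^ 3 + Polynomial.C (a 4) * Polynomial.X ^ 4
  have hp : p.degree ≠ 0 := by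
    intro h0
    have hC := Polynomial.eq_C_of_degree_eq_zero h0
    have c1 := congrArg (fun q => Polynomial.coeff q 1) hC
    have c2 := congrArg (fun q => Polynomial.coeff q 2) hC
    have c3 := congrArg (fun q => Polynomial.coeff q 3) hC
    have c4 := congrArg (fun q => Polynomial.coeff q 4) hC
    simp [p, Polynomial.coeff_X, Polynomial.coeff_C, Polynomial.coeff_X_pow] at c1 c2 c3 c4
    tauto
  obtain ⟨r, hr⟩ := IsAlgClosed.exists_root p hp
  refine ⟨r, ?_⟩
  simp [p, Polynomial.IsRoot] at hr
  rw [← hr]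

lemma lin_root [IsAlgClosed k] (a : Fin 4 → k) (h : a 1 ≠ 0 ∨ a 2 ≠ 0 ∨ a 3 ≠ 0) :
    ∃ r, a 0 + a 1 * r + a 2 * r ^ 2 + a 3 * r ^ 3 = 0 := by
  obtain ⟨r, hr⟩ := quart_root ![a 0, a 1, a 2, a 3, 0] (by simpa using h)
  exact ⟨r, by simpa using hr⟩

lemma kron [IsAlgClosed k] {P V : Type} [AddCommGroup P] [Module k P] [AddCommGroup V] [Module k V]
    [FiniteDimensional k P] [FiniteDimensional k V]
    (hP : Module.finrank k P = 3) (hV : Module.finrank k V = 4) (ν μ : P →ₗ[k] V)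
    (hinj : ∀ s t : k, (s ≠ 0 ∨ t ≠ 0) → ∀ x, s • ν x + t • μ x = 0 → x = 0) :
    ∃ p0 p1 p2 : P, ν p0 = μ p1 ∧ ν p1 = μ p2 ∧
      (∀ a b c : k, a • p0 + b • p1 + c • p2 = 0 → a = 0 ∧ b = 0 ∧ c = 0) ∧
      (∀ a b c d : k, a • μ p0 + b • ν p0 + c • ν p1 + d • ν p2 = 0 → a = 0 ∧ b = 0 ∧ c = 0 ∧ d = 0) := by
  let T : (P × P × P) →ₗ[k] (V × V) :=
    { toFun := fun z => (ν z.1 - μ z.2.1, ν z.2.1 - μ z.2.2)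
      map_add' := by intro x y; ext <;> simp <;> abel
      map_smul' := by intro c x; ext <;> simp [smul_sub] }
  have hker : LinearMap.ker T ≠ ⊥ := by
    intro h
    have := LinearMap.finrank_le_finrank_of_injective (LinearMap.ker_eq_bot.1 h)
    simp [hP, hV] at this
  obtain ⟨⟨p0, p1, p2⟩, hz, hne⟩ := Submodule.exists_mem_ne_zero_of_ne_bot hker
  have hz' : (ν p0 - μ p1, ν p1 - μ p2) = ((0 : V), (0 : V)) := hz
  rw [Prod.mk.injEq] at hz'
  have e1 := sub_eq_zero.1 hz'.1
  have e2 := sub_eq_zero.1 hz'.2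
  have hν : ∀ x, ν x = 0 → x = 0 := fun x hx => hinj 1 0 (by simp) x (by simp [hx])
  have hμ : ∀ x, μ x = 0 → x = 0 := fun x hx => hinj 0 1 (by simp) x (by simp [hx])
  have hp0 : p0 ≠ 0 := by
    rintro rfl
    have h1 := hμ p1 (by rw [← e1, map_zero])
    subst h1
    have h2 := hμ p2 (by rw [← e2, map_zero])
    subst h2
    exact hne rfl
  have hr : ∀ r : k, p1 ≠ r • p0 := by
    intro r h
    apply hp0
    refine hinj 1 (-r) (by simp) p0 ?_
    rw [e1, h]; simp
  have hli : ∀ a b c : k, a • p0 + b • p1 + c • p2 = 0 → a = 0 ∧ b = 0 ∧ c = 0 := by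
    intro a b c h
    by_cases hc : c = 0
    · subst hc
      by_cases hb : b = 0
      · subst hb
        simp [hp0] at h
        simp [h]
      · exfalso
        apply hr (-(b⁻¹ * a))
        have : b • p1 = -(a • p0) := by
          rw [zero_smul, add_zero] at h
          rw [eq_neg_iff_add_eq_zero, add_comm]; exact h
        rw [← inv_smul_smul₀ hb p1, this, smul_neg, smul_smul, neg_smul]
    · exfalso
      obtain ⟨r, hrt⟩ := lin_root ![a, b, c, 0] (by simp [hc])
      simp at hrt
      -- c t² + b t + a = (t - r)(c t + (b + c r))
      apply hr r
      have hu : p1 - r • p0 = 0 := by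
        refine hinj c (b + c * r) (by simp [hc]) _ ?_
        have : a • μ p0 + b • μ p1 + c • μ p2 = 0 := by
          have := congrArg μ h
          simpa using this
        rw [map_sub, map_sub, map_smul, map_smul, e1, e2]
        rw [← this]
        have ha : a = - (b * r + c * r ^ 2) := by linear_combination hrt
        rw [ha]
        module
      exact sub_eq_zero.1 hu
  refine ⟨p0, p1, p2, e1, e2, hli, ?_⟩
  intro a b c d h
  by_cases hd : d = 0
  · subst hd
    rw [zero_smul, add_zero, e1, e2, ← map_smul, ← map_smul, ← map_smul, ← map_add, ← map_add] at h
    have := hli _ _ _ (hμ _ h)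
    simp [this]
  · exfalso
    obtain ⟨r, hrt⟩ := lin_root ![a, b, c, d] (by simp [hd])
    simp at hrt
    have hu : (b + r * (c + r * d)) • p0 + (c + r * d) • p1 + d • p2 = 0 := by
      refine hinj 1 (-r) (by simp) _ ?_
      rw [← h]
      simp only [map_add, map_smul, ← e1, ← e2]
      have ha : a = - (b * r + c * r ^ 2 + d * r ^ 3) := by linear_combination hrt
      rw [ha]
      module
    exact hd (hli _ _ _ hu).2.2
end partPF1

section partPF2
lemma pderiv_comm' (i j : Fin 4) (F : MvPolynomial (Fin 4) k) : pderiv i (pderiv j F) = pderiv j (pderiv i F) := by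
  have h : ⁅(pderiv i : Derivation k (MvPolynomial (Fin 4) k) (MvPolynomial (Fin 4) k)), (pderiv j : Derivation k (MvPolynomial (Fin 4) k) (MvPolynomial (Fin 4) k))⁆ = 0 := by
    apply derivation_ext
    intro a
    rw [Derivation.commutator_apply, pX, pX, pderiv_C, pderiv_C]; simp
  have := congrArg (fun D => D F) h
  simp only [Derivation.commutator_apply, Derivation.zero_apply] at this
  exact sub_eq_zero.1 this

lemma dirDeriv_comm (v w : Fin 4 → k) (F : MvPolynomial (Fin 4) k) :
    dirDeriv v (dirDeriv w F) = dirDeriv w (dirDeriv v F) := by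
  simp only [dirDeriv, map_sum, Derivation.map_smul, Finset.smul_sum]
  rw [Finset.sum_comm]
  refine Finset.sum_congr rfl fun i _ => Finset.sum_congr rfl fun j _ => ?_
  rw [smul_comm]
  congr 2
  exact pderiv_comm' _ _ _

lemma vl_inj {w : Fin 4 → k} (h : vl w = 0) : w = 0 := by
  funext i
  have := congrArg (eval (Pi.single i 1)) h
  simpa [eval_vl] using this

def dV (F : MvPolynomial (Fin 4) k) : (Fin 4 → k) →ₗ[k] MvPolynomial (Fin 4) k where
  toFun v := dirDeriv v F
  map_add' v w := by simp [dirDeriv, add_smul, Finset.sum_add_distrib]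
  map_smul' c v := by simp [dirDeriv, mul_smul, Finset.smul_sum]

lemma dV_apply (F : MvPolynomial (Fin 4) k) (v) : dV F v = dirDeriv v F := rfl

lemma dV_homog {F : MvPolynomial (Fin 4) k} (hF : F.IsHomogeneous 3) (v) : (dirDeriv v F).IsHomogeneous 2 := by
  refine IsHomogeneous.sum _ _ _ fun i _ => ?_
  rw [smul_eq_C_mul]
  exact IsHomogeneous.C_mul (hF.pderiv) _

lemma dV_symm (h2 : (2:k) ≠ 0) {F : MvPolynomial (Fin 4) k} (hF : F.IsHomogeneous 3) (v w) :
    (gram (dirDeriv v F)).mulVec w = (gram (dirDeriv w F)).mulVec v := by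
  have e : ∀ v w : Fin 4 → k, dirDeriv w (dirDeriv v F) = 2 * vl ((gram (dirDeriv v F)).mulVec w) := by
    intro v w
    conv_lhs => rw [← quad_gram h2 (dV_homog hF v)]
    rw [dirDeriv_quad _ (gram_symm _), vl_apply]
  have h := e v w
  rw [dirDeriv_comm, e w v] at h
  rw [← sub_eq_zero]
  apply vl_inj
  rw [map_sub]
  have h2' : (2 : MvPolynomial (Fin 4) k) ≠ 0 := by
    rw [← map_ofNat C 2, Ne, C_eq_zero]; exact h2
  rw [sub_eq_zero]
  exact (mul_left_cancel₀ h2' h).symm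

lemma der_fg (h2 : (2:k) ≠ 0) {L : Submodule k (MvPolynomial (Fin 4) k)} (hdim : Module.finrank k L = 3) (hd : IsDer L) :
    ∃ (f : (Fin 3 → k) →ₗ[k] MvPolynomial (Fin 4) k) (g : (Fin 3 → k) →ₗ[k] (Fin 4 → k)),
      LinearMap.range f = L ∧ Function.Injective f ∧ g ≠ 0 ∧
      ∀ x y, (gram (f x)).mulVec (g y) = (gram (f y)).mulVec (g x) := by
  obtain ⟨F, v₁, v₂, v₃, hF, hL⟩ := hd
  let g := Fintype.linearCombination k ![v₁, v₂, v₃]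
  have hr : LinearMap.range (dV F ∘ₗ g) = L := by
    rw [LinearMap.range_comp, Fintype.range_linearCombination, ← Submodule.span_image, hL]
    congr 1
    ext x
    simp [dV_apply, eq_comm]
    tauto
  have hi : Function.Injective (dV F ∘ₗ g) := by
    rw [← LinearMap.ker_eq_bot]
    have := LinearMap.finrank_range_add_finrank_ker (dV F ∘ₗ g)
    rw [hr, hdim] at this
    simp at this
    exact this
  refine ⟨dV F ∘ₗ g, g, hr, hi, ?_, fun x y => dV_symm h2 hF _ _⟩
  intro h0
  rw [h0, LinearMap.comp_zero, LinearMap.range_zero] at hr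
  rw [← hr] at hdim
  simp at hdim

lemma two_g (h2 : (2:k) ≠ 0) (A : Fin 3 → Matrix (Fin 4) (Fin 4) k) (hA : ∀ i, (A i).IsSymm)
    (x : Fin 3 → Fin 4 → k) (hx : x ≠ 0) (hs : ∀ i j, (A i).mulVec (x j) = (A j).mulVec (x i)) :
    ∃ x', LinearIndependent k ![x, x'] ∧ ∀ i j, (A i).mulVec (x' j) = (A j).mulVec (x' i) := by
  have hd : ∀ i (u v : Fin 4 → k), u ⬝ᵥ (A i).mulVec v = v ⬝ᵥ (A i).mulVec u := by
    intro i u v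
    rw [Matrix.dotProduct_mulVec, ← Matrix.mulVec_transpose, (hA i).eq, dotProduct_comm]
  let B : LinearMap.BilinForm k (Fin 3 → Fin 4 → k) := LinearMap.mk₂ k
    (fun ν μ => ν 0 ⬝ᵥ ((A 1).mulVec (μ 2) - (A 2).mulVec (μ 1)) + ν 1 ⬝ᵥ ((A 2).mulVec (μ 0) - (A 0).mulVec (μ 2))
      + ν 2 ⬝ᵥ ((A 0).mulVec (μ 1) - (A 1).mulVec (μ 0)))
    (by intro a b c; simp only [Pi.add_apply, add_dotProduct]; ring)
    (by intro a b c; simp only [Pi.smul_apply, smul_dotProduct, smul_eq_mul]; ring)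
    (by intro a b c; simp only [Pi.add_apply, Matrix.mulVec_add, dotProduct_add, dotProduct_sub]; ring)
    (by intro a b c; simp only [Pi.smul_apply, Matrix.mulVec_smul, dotProduct_sub, dotProduct_smul, smul_eq_mul]; ring)
  have hB : ∀ ν μ, B ν μ = ν 0 ⬝ᵥ ((A 1).mulVec (μ 2) - (A 2).mulVec (μ 1)) + ν 1 ⬝ᵥ ((A 2).mulVec (μ 0) - (A 0).mulVec (μ 2))
      + ν 2 ⬝ᵥ ((A 0).mulVec (μ 1) - (A 1).mulVec (μ 0)) := fun _ _ => rfl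
  have hsk : ∀ x y, B x y = - B y x := by
    intro x y
    rw [hB, hB]
    simp only [dotProduct_sub]
    rw [hd 1 (x 0), hd 2 (x 0), hd 2 (x 1), hd 0 (x 1), hd 0 (x 2), hd 1 (x 2)]
    ring
  obtain ⟨x', hli, hx'⟩ := skew_ker h2 B hsk (by rw [Module.finrank_pi_fintype]; simp; decide) hx (by
    intro y
    rw [hsk, hB, hs 1 2, hs 2 0, hs 0 1]; simp)
  refine ⟨x', hli, ?_⟩
  have hz : ∀ ν, B ν x' = 0 := fun ν => by rw [hsk, hx', neg_zero]
  have h12 : (A 1).mulVec (x' 2) = (A 2).mulVec (x' 1) := by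
    rw [← sub_eq_zero]
    refine dotProduct_eq_zero _ fun u => ?_
    have := hz (Pi.single 0 u)
    rw [hB] at this
    rw [dotProduct_comm]; simpa using this
  have h20 : (A 2).mulVec (x' 0) = (A 0).mulVec (x' 2) := by
    rw [← sub_eq_zero]
    refine dotProduct_eq_zero _ fun u => ?_
    have := hz (Pi.single 1 u)
    rw [hB] at this
    rw [dotProduct_comm]; simpa using this
  have h01 : (A 0).mulVec (x' 1) = (A 1).mulVec (x' 0) := by
    rw [← sub_eq_zero]
    refine dotProduct_eq_zero _ fun u => ?_
    have := hz (Pi.single 2 u)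
    rw [hB] at this
    rw [dotProduct_comm]; simpa using this
  intro i j
  fin_cases i <;> fin_cases j <;> first | rfl | assumption | (symm; assumption)

lemma lc_symm (f : (Fin 3 → k) →ₗ[k] MvPolynomial (Fin 4) k) (g : (Fin 3 → k) →ₗ[k] (Fin 4 → k))
    (h : ∀ i j, (gram (f (Pi.single i 1))).mulVec (g (Pi.single j 1)) = (gram (f (Pi.single j 1))).mulVec (g (Pi.single i 1)))
    (x y) : (gram (f x)).mulVec (g y) = (gram (f y)).mulVec (g x) := by
  have e : ∀ x y, (gram (f x)).mulVec (g y) = ∑ i, ∑ j, (x i * y j) • (gram (f (Pi.single i 1))).mulVec (g (Pi.single j 1)) := by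
    intro x y
    conv_lhs => rw [pi_eq_sum_univ' x, pi_eq_sum_univ' y]
    simp only [map_sum, map_smul, ← gramL_apply, Matrix.sum_mulVec, Matrix.mulVec_sum, Matrix.smul_mulVec, Matrix.mulVec_smul, Finset.smul_sum, smul_smul]
    rw [Finset.sum_comm]
    exact Finset.sum_congr rfl fun i _ => Finset.sum_congr rfl fun j _ => by rw [mul_comm]
  rw [e, e, Finset.sum_comm]
  refine Finset.sum_congr rfl fun i _ => Finset.sum_congr rfl fun j _ => ?_
  rw [h, mul_comm]

lemma hank_data [IsAlgClosed k] (h2 : (2:k) ≠ 0) {L : Submodule k (MvPolynomial (Fin 4) k)} (hdim : Module.finrank k L = 3)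
    (hsec : ∀ q ∈ L, q ≠ 0 → ¬ (gram q).rank ≤ 2) (hd : IsDer L) :
    ∃ (e : Fin 3 → MvPolynomial (Fin 4) k) (y : Fin 4 → Fin 4 → k), LinearIndependent k e ∧ Submodule.span k (Set.range e) = L ∧
      LinearIndependent k y ∧
      (∀ i j : Fin 3, (gram (e i)).mulVec (y j.castSucc) = (gram (e j)).mulVec (y i.castSucc)) ∧
      (∀ i j : Fin 3, (gram (e i)).mulVec (y j.succ) = (gram (e j)).mulVec (y i.succ)) := by
  obtain ⟨f, g, hr, hf, hg, hs⟩ := der_fg h2 hdim hd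
  have hfL : ∀ x, f x ∈ L := fun x => by rw [← hr]; exact ⟨x, rfl⟩
  have hg' : (fun i => g (Pi.single i 1)) ≠ 0 := by
    intro h
    apply hg
    refine LinearMap.pi_ext' fun i => ?_
    ext1
    exact congrFun h i
  obtain ⟨x', hli, hx'⟩ := two_g h2 (fun i => gram (f (Pi.single i 1))) (fun i => gram_symm _)
    (fun i => g (Pi.single i 1)) hg' (fun i j => hs _ _)
  let m := Fintype.linearCombination k x'
  have hm1 : ∀ i, m (Pi.single i 1) = x' i := by intro i; simp [m]
  have hms : ∀ x y, (gram (f x)).mulVec (m y) = (gram (f y)).mulVec (m x) := by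
    apply lc_symm
    intro i j
    rw [hm1, hm1]; exact hx' i j
  obtain ⟨p0, p1, p2, e1, e2, hp, hy⟩ := kron (by simp) (by simp) g m (by
    intro s t hst x hx
    have hne : s • g + t • m ≠ 0 := by
      intro h
      have := LinearIndependent.pair_iff.1 hli s t (by
        funext i
        have := LinearMap.congr_fun h (Pi.single i 1)
        simpa [hm1] using this)
      tauto
    have := sym_g hsec (by simp) hfL (g := s • g + t • m) (by
      intro x y
      simp only [LinearMap.add_apply, LinearMap.smul_apply, Matrix.mulVec_add, Matrix.mulVec_smul]
      rw [hs x y, hms x y]) hf hne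
    apply this
    simpa using hx)
  have hlp : LinearIndependent k ![p0, p1, p2] := by
    rw [Fintype.linearIndependent_iff]
    intro c hc
    have := hp (c 0) (c 1) (c 2) (by simpa [Fin.sum_univ_three] using hc)
    intro i; fin_cases i <;> simp [this]
  have hle : LinearIndependent k (f ∘ ![p0, p1, p2]) := hlp.map' f (LinearMap.ker_eq_bot.2 hf)
  refine ⟨f ∘ ![p0, p1, p2], ![m p0, g p0, g p1, g p2], hle, ?_, ?_, ?_, ?_⟩
  · have : FiniteDimensional k L := Module.finite_of_finrank_pos (by omega)
    refine Submodule.eq_of_le_of_finrank_eq ?_ ?_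
    · rw [Submodule.span_le]; rintro _ ⟨i, rfl⟩; exact hfL _
    · rw [finrank_span_eq_card hle, hdim]; simp
  · rw [Fintype.linearIndependent_iff]
    intro c hc
    have := hy (c 0) (c 1) (c 2) (c 3) (by simpa [Fin.sum_univ_four] using hc)
    intro i; fin_cases i <;> simp [this]
  · have : ∀ j : Fin 3, (![m p0, g p0, g p1, g p2] : Fin 4 → Fin 4 → k) j.castSucc = m (![p0, p1, p2] j) := by
      intro j; fin_cases j
      · rfl
      · exact e1
      · exact e2
    intro i j
    rw [this, this]; exact hms _ _
  · have : ∀ j : Fin 3, (![m p0, g p0, g p1, g p2] : Fin 4 → Fin 4 → k) j.succ = g (![p0, p1, p2] j) := by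
      intro j; fin_cases j <;> rfl
    intro i j
    rw [this, this]; exact hs _ _
end partPF2

section partPF3
lemma hank_psi (A : Fin 3 → Matrix (Fin 4) (Fin 4) k) (hA : ∀ i, (A i).IsSymm) (y : Fin 4 → Fin 4 → k)
    (hs0 : ∀ i j : Fin 3, (A i).mulVec (y j.castSucc) = (A j).mulVec (y i.castSucc))
    (hs1 : ∀ i j : Fin 3, (A i).mulVec (y j.succ) = (A j).mulVec (y i.succ)) :
    ∃ ψ : ℕ → k, ∀ i m j, y m ⬝ᵥ (A i).mulVec (y j) = ψ ((i:ℕ) + m + j) := by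
  have hd : ∀ i (u v : Fin 4 → k), u ⬝ᵥ (A i).mulVec v = v ⬝ᵥ (A i).mulVec u := by
    intro i u v
    rw [Matrix.dotProduct_mulVec, ← Matrix.mulVec_transpose, (hA i).eq, dotProduct_comm]
  let T : Fin 3 → Fin 4 → Fin 4 → k := fun i m j => y m ⬝ᵥ (A i).mulVec (y j)
  have t0 : ∀ i m j, T i m j = T i j m := fun i m j => hd i _ _
  have t1 : ∀ (i : Fin 2) (m) (j : Fin 3), T i.castSucc m j.succ = T i.succ m j.castSucc := by
    intro i m j
    have e1 := hs1 i.castSucc j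
    have e2 := hs0 i.succ j
    simp only [T]
    rw [e1, e2]; rfl
  let ψ : ℕ → k := fun n => match n with
    | 0 => T 0 0 0
    | 1 => T 1 0 0
    | 2 => T 2 0 0
    | 3 => T 2 0 1
    | 4 => T 2 0 2
    | 5 => T 2 0 3
    | 6 => T 2 1 3
    | 7 => T 2 2 3
    | _ => T 2 3 3
  have u : ∀ (m j : Fin 3), T 2 m.succ j.castSucc = T 2 m.castSucc j.succ := by
    intro m j
    have e1 := t1 1 m.succ j
    have e2 := t1 1 j.succ m
    have e3 := t0 1 m.succ j.succ
    have e4 := t0 2 m.castSucc j.succ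
    exact (e1.symm.trans e3).trans (e2.trans e4.symm)
  refine ⟨ψ, ?_⟩
  have a2 : ∀ m j, T 2 m j = ψ (2 + m + j) := by
    intro m j
    have u00 := u 0 0
    have u01 := u 0 1
    have u02 := u 0 2
    have u10 := u 1 0
    have u11 := u 1 1
    have u12 := u 1 2
    have u20 := u 2 0
    have u21 := u 2 1
    have u22 := u 2 2
    have s := t0 2 3 0
    fin_cases m <;> fin_cases j <;> simp [ψ] at * <;> grind
  have a1 : ∀ m j, T 1 m j = ψ (1 + m + j) := by
    have h : ∀ m (j : Fin 3), T 1 m j.succ = ψ (1 + m + (j.succ : Fin 4)) := by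
      intro m j
      refine (t1 1 m j).trans ?_
      refine (a2 _ _).trans ?_
      congr 1
      simp; omega
    intro m j
    rcases Fin.eq_zero_or_eq_succ j with rfl | ⟨j, rfl⟩
    · rcases Fin.eq_zero_or_eq_succ m with rfl | ⟨m, rfl⟩
      · rfl
      · rw [t0, h]; congr 1
    · exact h m j
  have a0 : ∀ m j, T 0 m j = ψ (0 + m + j) := by
    have h : ∀ m (j : Fin 3), T 0 m j.succ = ψ (0 + m + (j.succ : Fin 4)) := by
      intro m j
      refine (t1 0 m j).trans ?_
      refine (a1 _ _).trans ?_
      congr 1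
      simp; omega
    intro m j
    rcases Fin.eq_zero_or_eq_succ j with rfl | ⟨j, rfl⟩
    · rcases Fin.eq_zero_or_eq_succ m with rfl | ⟨m, rfl⟩
      · rfl
      · rw [t0, h]; congr 1
    · exact h m j
  intro i m j
  fin_cases i
  · exact a0 m j
  · exact a1 m j
  · exact a2 m j

lemma inn_vlvl (h2 : (2:k) ≠ 0) (u v : Fin 4 → k) {M : Matrix (Fin 4) (Fin 4) k} (hM : M.IsSymm) :
    inn (gram (vl u * vl v)) M = u ⬝ᵥ M.mulVec v := by
  have e : vl u * vl v = ∑ i, ∑ j, (u i * v j) • (X i * X j : MvPolynomial (Fin 4) k) := by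
    rw [vl_apply, vl_apply, Finset.sum_mul_sum]
    refine Finset.sum_congr rfl fun i _ => Finset.sum_congr rfl fun j _ => ?_
    rw [smul_eq_C_mul, C_mul]; ring
  have h : ∀ i j, inn (gram (X i * X j : MvPolynomial (Fin 4) k)) M = M i j := by
    intro i j
    simp only [inn, gram_XX h2]
    have : ∀ a b, ((if i = a ∧ j = b then (1:k) else 0) + (if i = b ∧ j = a then 1 else 0)) / 2 * M a b =
      (if i = a then if j = b then M a b / 2 else 0 else 0) + (if j = a then if i = b then M a b / 2 else 0 else 0) := by
      intro a b
      simp only [ite_and]; split_ifs <;> ring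
    simp only [this, Finset.sum_add_distrib]
    simp
    rw [hM.apply i j, ← two_mul]; field_simp
  have hl : inn (gram (vl u * vl v)) M = ∑ i, ∑ j, (u i * v j) * M i j := by
    have : ∀ (s : Fin 4 → Fin 4 → k), inn (gram (∑ i, ∑ j, s i j • (X i * X j : MvPolynomial (Fin 4) k))) M = ∑ i, ∑ j, s i j * inn (gram (X i * X j)) M := by
      intro s
      let φ : MvPolynomial (Fin 4) k →ₗ[k] k :=
        { toFun := fun p => inn (gram p) M
          map_add' := by
            intro p q
            simp only [← gramL_apply, map_add, inn, Matrix.add_apply, add_mul, Finset.sum_add_distrib]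
          map_smul' := by
            intro c p
            simp only [← gramL_apply, map_smul, inn, Matrix.smul_apply, smul_eq_mul, mul_assoc, Finset.mul_sum, RingHom.id_apply] }
      have : φ (∑ i, ∑ j, s i j • (X i * X j)) = ∑ i, ∑ j, s i j * φ (X i * X j) := by
        simp only [map_sum, map_smul, smul_eq_mul]
      exact this
    rw [e, this]
    simp only [h]
  rw [hl]
  simp only [dotProduct, Matrix.mulVec, Finset.mul_sum]
  refine Finset.sum_congr rfl fun i _ => Finset.sum_congr rfl fun j _ => ?_
  ring
end partPF3

section partPF4
def Gp {R : Type} [CommRing R] [Algebra k R] (a b c U V : R) (d : Fin 6 → k) : R :=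
  a * V * V - b * U * V + c * U * U
  + d 0 • (a * a * U) - d 1 • (a * a * V) - (d 0 * d 4) • (a * a * c) + (d 1 * d 3) • (a * a * c)
  + d 1 • (a * b * U) - d 2 • (a * b * V) + (d 0 * d 4) • (a * b * b) - (d 1 * d 3) • (a * b * b)
  - (d 0 * d 5) • (a * b * c) + (d 2 * d 3) • (a * b * c) - d 2 • (a * c * U) - d 3 • (a * c * V)
  - (d 1 * d 5) • (a * c * c) + (d 2 * d 4) • (a * c * c) + d 2 • (b * b * U) + d 3 • (b * b * V)
  + (d 0 * d 5) • (b * b * b) - (d 2 * d 3) • (b * b * b) + (d 1 * d 5) • (b * b * c) - (d 2 * d 4) • (b * b * c)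
  - d 3 • (b * c * U) + d 4 • (b * c * V) - d 4 • (c * c * U) + d 5 • (c * c * V)

lemma Gp_map {R S : Type} [CommRing R] [Algebra k R] [CommRing S] [Algebra k S] (φ : R →ₐ[k] S)
    (a b c U V : R) (d : Fin 6 → k) : φ (Gp a b c U V d) = Gp (φ a) (φ b) (φ c) (φ U) (φ V) d := by
  simp only [Gp, map_add, map_sub, map_mul, map_smul]

def ZU {R : Type} [CommRing R] [Algebra k R] (Y : Fin 4 → R) (d : Fin 6 → k) : R :=
  d 0 • (Y 0 * Y 0) + d 1 • (Y 0 * Y 1) + d 2 • (Y 0 * Y 2) + d 3 • (Y 0 * Y 3) + d 4 • (Y 1 * Y 3) + d 5 • (Y 2 * Y 3)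

def ZV {R : Type} [CommRing R] [Algebra k R] (Y : Fin 4 → R) (d : Fin 6 → k) : R :=
  d 0 • (Y 0 * Y 1) + d 1 • (Y 0 * Y 2) + d 2 • (Y 0 * Y 3) + d 3 • (Y 1 * Y 3) + d 4 • (Y 2 * Y 3) + d 5 • (Y 3 * Y 3)

set_option maxHeartbeats 1000000 in
lemma Gp_zero {R : Type} [CommRing R] [Algebra k R] (Y : Fin 4 → R) (d : Fin 6 → k) :
    Gp (Y 0 * Y 2 - Y 1 * Y 1) (Y 0 * Y 3 - Y 1 * Y 2) (Y 1 * Y 3 - Y 2 * Y 2) (ZU Y d) (ZV Y d) d = 0 := by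
  simp only [Gp, ZU, ZV, Algebra.smul_def, map_mul]
  generalize algebraMap k R (d 0) = d0
  generalize algebraMap k R (d 1) = d1
  generalize algebraMap k R (d 2) = d2
  generalize algebraMap k R (d 3) = d3
  generalize algebraMap k R (d 4) = d4
  generalize algebraMap k R (d 5) = d5
  generalize Y 0 = y0
  generalize Y 1 = y1
  generalize Y 2 = y2
  generalize Y 3 = y3
  ring

lemma ZU_add {R : Type} [CommRing R] [Algebra k R] (Y : Fin 4 → R) (d d' : Fin 6 → k) :
    ZU Y d + ZU Y d' = ZU Y (d + d') := by
  simp only [ZU, Pi.add_apply, add_smul]; abel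

lemma ZV_add {R : Type} [CommRing R] [Algebra k R] (Y : Fin 4 → R) (d d' : Fin 6 → k) :
    ZV Y d + ZV Y d' = ZV Y (d + d') := by
  simp only [ZV, Pi.add_apply, add_smul]; abel

lemma Gp_homog {σ : Type} {a b c U V : MvPolynomial σ k} (ha : a.IsHomogeneous 1) (hb : b.IsHomogeneous 1)
    (hc : c.IsHomogeneous 1) (hU : U.IsHomogeneous 1) (hV : V.IsHomogeneous 1) (d : Fin 6 → k) :
    (Gp a b c U V d) ∈ homogeneousSubmodule σ k 3 := by
  have h : ∀ {x y z : MvPolynomial σ k}, x.IsHomogeneous 1 → y.IsHomogeneous 1 → z.IsHomogeneous 1 →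
    x * y * z ∈ homogeneousSubmodule σ k 3 := fun hx hy hz => (hx.mul hy).mul hz
  generalize homogeneousSubmodule σ k 3 = N at h
  have hadd : ∀ {x y : MvPolynomial σ k}, x ∈ N → y ∈ N → x + y ∈ N := fun hx hy => N.add_mem hx hy
  have hsub : ∀ {x y : MvPolynomial σ k}, x ∈ N → y ∈ N → x - y ∈ N := fun hx hy => N.sub_mem hx hy
  have hsm : ∀ (t : k) {x : MvPolynomial σ k}, x ∈ N → t • x ∈ N := fun t _ hx => N.smul_mem t hx
  unfold Gp
  repeat' first
    | assumption
    | with_reducible apply hadd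
    | with_reducible apply hsub
    | with_reducible apply hsm
    | with_reducible apply h

def GG (D D' : Fin 6 → k) : Fin 3 → MvPolynomial (Fin 7) k :=
  ![Gp (X 0) (X 1) (X 2) (X 3) (X 4) D, Gp (X 0) (X 1) (X 2) (X 5) (X 6) D',
    Gp (X 0) (X 1) (X 2) (X 3 + X 5) (X 4 + X 6) (D + D')]

lemma GG_homog (D D' : Fin 6 → k) (i) : GG D D' i ∈ homogeneousSubmodule (Fin 7) k 3 := by
  have h := fun i : Fin 7 => isHomogeneous_X k i
  fin_cases i
  · exact Gp_homog (h _) (h _) (h _) (h _) (h _) _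
  · exact Gp_homog (h _) (h _) (h _) (h _) (h _) _
  · exact Gp_homog (h _) (h _) (h _) ((h _).add (h _)) ((h _).add (h _)) _

def EE {R : Type} [CommRing R] [Algebra k R] (Y : Fin 4 → R) (D D' : Fin 6 → k) : Fin 7 → R :=
  ![Y 0 * Y 2 - Y 1 * Y 1, Y 0 * Y 3 - Y 1 * Y 2, Y 1 * Y 3 - Y 2 * Y 2, ZU Y D, ZV Y D, ZU Y D', ZV Y D']

lemma GG_EE {R : Type} [CommRing R] [Algebra k R] (Y : Fin 4 → R) (D D' : Fin 6 → k) (i) :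
    aeval (EE Y D D') (GG D D' i) = 0 := by
  fin_cases i
  · refine (Gp_map _ _ _ _ _ _ _).trans ?_
    simp only [aeval_X]
    exact Gp_zero Y D
  · refine (Gp_map _ _ _ _ _ _ _).trans ?_
    simp only [aeval_X]
    exact Gp_zero Y D'
  · refine (Gp_map _ _ _ _ _ _ _).trans ?_
    simp only [aeval_X, map_add]
    refine Eq.trans ?_ (Gp_zero Y (D + D'))
    rw [← ZU_add, ← ZV_add]
    rfl

lemma GG_li (h2 : (2:k) ≠ 0) (D D' : Fin 6 → k) : LinearIndependent k (GG D D') := by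
  rw [Fintype.linearIndependent_iff]
  intro g hg
  have key : ∀ s t : k, g 0 * (s ^ 2 - s * D 1) + g 1 * (t ^ 2 - t * D' 1) + g 2 * ((s + t) ^ 2 - (s + t) * (D 1 + D' 1)) = 0 := by
    intro s t
    have := congrArg (aeval (![1, 0, 0, 0, s, 0, t] : Fin 7 → k)) hg
    rw [map_sum, Fin.sum_univ_three, map_smul, map_smul, map_smul, map_zero] at this
    simp only [GG, Matrix.cons_val_zero, Matrix.cons_val_one, Matrix.cons_val, Gp_map, aeval_X, map_add] at this
    rw [← this]
    simp [Gp]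
    ring
  have k1 := key 1 0
  have k2 := key (-1) 0
  have k3 := key 0 1
  have k4 := key 0 (-1)
  have k5 := key 1 1
  have k6 := key (-1) (-1)
  have h4 : ∀ x : k, 2 * x = 0 → x = 0 := fun x hx => (mul_eq_zero.1 hx).resolve_left h2
  have l1 : g 0 + g 2 = 0 := h4 _ (by linear_combination k1 + k2)
  have l2 : g 1 + g 2 = 0 := h4 _ (by linear_combination k3 + k4)
  have l3 : g 0 + g 1 + 4 * g 2 = 0 := h4 _ (by linear_combination k5 + k6)
  have l4 : g 2 = 0 := h4 _ (by linear_combination l3 - l1 - l2)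
  rw [l4, add_zero] at l1 l2
  intro i; fin_cases i
  · exact l1
  · exact l2
  · exact l4
end partPF4

section partPF5
lemma hank_ker (ψ : ℕ → k) : ∃ D D' : Fin 6 → k, LinearIndependent k ![D, D'] ∧
    (∀ j : Fin 4, ∑ i : Fin 6, D i * ψ (i + j) = 0) ∧ (∀ j : Fin 4, ∑ i : Fin 6, D' i * ψ (i + j) = 0) := by
  let M : Matrix (Fin 4) (Fin 6) k := Matrix.of fun j i => ψ (i + j)
  have h1 := LinearMap.finrank_range_add_finrank_ker M.mulVecLin
  have h2 := Submodule.finrank_le (LinearMap.range M.mulVecLin)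
  simp at h1 h2
  have h3 : 2 ≤ Module.finrank k (LinearMap.ker M.mulVecLin) := by omega
  obtain ⟨v, hv⟩ := exists_linearIndependent_of_le_finrank h3
  have hv' := hv.map' (LinearMap.ker M.mulVecLin).subtype (Submodule.ker_subtype _)
  rw [fin2_eta (_ ∘ v)] at hv'
  have hk : ∀ w : LinearMap.ker M.mulVecLin, ∀ j : Fin 4, ∑ i : Fin 6, w.1 i * ψ (i + j) = 0 := by
    intro w j
    have := congrFun w.2 j
    simp only [Matrix.mulVecLin_apply, Matrix.mulVec, dotProduct, M, Matrix.of_apply, Pi.zero_apply] at this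
    rw [← this]
    exact Finset.sum_congr rfl fun i _ => mul_comm _ _
  exact ⟨v 0, v 1, hv', hk _, hk _⟩

lemma perp_e (h2 : (2:k) ≠ 0) {L : Submodule k (MvPolynomial (Fin 4) k)}
    (hL : L ≤ homogeneousSubmodule (Fin 4) k 2) {e : Fin 3 → MvPolynomial (Fin 4) k}
    (he : Submodule.span k (Set.range e) = L) {p : MvPolynomial (Fin 4) k} (hp : p.IsHomogeneous 2)
    (h : ∀ i, innB p (e i) = 0) : p ∈ perpSet L := by
  rw [mem_perp h2 hL]
  refine ⟨hp, fun f hf => ?_⟩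
  rw [← innB_apply]
  have : L ≤ LinearMap.ker (innB p) := by
    rw [← he, Submodule.span_le]
    rintro _ ⟨i, rfl⟩
    exact h i
  exact this hf

lemma EE_perp (h2 : (2:k) ≠ 0) {L : Submodule k (MvPolynomial (Fin 4) k)}
    (hL : L ≤ homogeneousSubmodule (Fin 4) k 2) {e : Fin 3 → MvPolynomial (Fin 4) k}
    (he : Submodule.span k (Set.range e) = L) {y : Fin 4 → Fin 4 → k} {ψ : ℕ → k}
    (hψ : ∀ i m j, y m ⬝ᵥ (gram (e i)).mulVec (y j) = ψ ((i:ℕ) + m + j)) {D D' : Fin 6 → k}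
    (hD : ∀ j : Fin 4, ∑ i : Fin 6, D i * ψ (i + j) = 0) (hD' : ∀ j : Fin 4, ∑ i : Fin 6, D' i * ψ (i + j) = 0)
    (i : Fin 7) : EE (fun j => vl (y j)) D D' i ∈ perpSet L := by
  have hh : ∀ a b, vl (y a) * vl (y b) ∈ homogeneousSubmodule (Fin 4) k 2 := fun a b => (vl_homog _).mul (vl_homog _)
  have hi : ∀ a b i, innB (vl (y a) * vl (y b)) (e i) = ψ ((i:ℕ) + a + b) := by
    intro a b i
    rw [innB_apply, inn_vlvl h2 _ _ (gram_symm _), hψ]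
  have hU : ∀ D : Fin 6 → k, (∀ j : Fin 4, ∑ i : Fin 6, D i * ψ (i + j) = 0) → ZU (fun j => vl (y j)) D ∈ perpSet L := by
    intro D hD
    refine perp_e h2 hL he ?_ ?_
    · change ZU (fun j => vl (y j)) D ∈ homogeneousSubmodule (Fin 4) k 2
      unfold ZU
      refine Submodule.add_mem _ (Submodule.add_mem _ (Submodule.add_mem _ (Submodule.add_mem _ (Submodule.add_mem _ ?_ ?_) ?_) ?_) ?_) ?_
      all_goals exact Submodule.smul_mem _ _ (hh _ _)
    · intro i
      have := hD i.castSucc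
      unfold ZU
      simp only [map_add, map_smul, LinearMap.add_apply, LinearMap.smul_apply, hi]
      rw [← this, Fin.sum_univ_six]
      fin_cases i <;> simp
  have hV : ∀ D : Fin 6 → k, (∀ j : Fin 4, ∑ i : Fin 6, D i * ψ (i + j) = 0) → ZV (fun j => vl (y j)) D ∈ perpSet L := by
    intro D hD
    refine perp_e h2 hL he ?_ ?_
    · change ZV (fun j => vl (y j)) D ∈ homogeneousSubmodule (Fin 4) k 2
      unfold ZV
      refine Submodule.add_mem _ (Submodule.add_mem _ (Submodule.add_mem _ (Submodule.add_mem _ (Submodule.add_mem _ ?_ ?_) ?_) ?_) ?_) ?_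
      all_goals exact Submodule.smul_mem _ _ (hh _ _)
    · intro i
      have := hD i.succ
      unfold ZV
      simp only [map_add, map_smul, LinearMap.add_apply, LinearMap.smul_apply, hi]
      rw [← this, Fin.sum_univ_six]
      fin_cases i <;> simp
  have hM : ∀ a b c d : Fin 4, (a:ℕ) + b = c + d → vl (y a) * vl (y b) - vl (y c) * vl (y d) ∈ perpSet L := by
    intro a b c d h
    refine perp_e h2 hL he (Submodule.sub_mem _ (hh _ _) (hh _ _)) fun i => ?_
    rw [map_sub, LinearMap.sub_apply, hi, hi, add_assoc, h, ← add_assoc, sub_self]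
  fin_cases i
  · exact hM 0 2 1 1 rfl
  · exact hM 0 3 1 2 rfl
  · exact hM 1 3 2 2 rfl
  · exact hU D hD
  · exact hV D hD
  · exact hU D' hD'
  · exact hV D' hD'

lemma EE_coef {y : Fin 4 → Fin 4 → k} (hy : LinearIndependent k y) {D D' : Fin 6 → k} {g : Fin 7 → k}
    (hg : ∑ i, g i • EE (fun j => vl (y j)) D D' i = 0) :
    g 0 = 0 ∧ g 1 = 0 ∧ g 2 = 0 ∧ g 3 * D 0 + g 5 * D' 0 = 0 ∧ g 3 * D 1 + g 4 * D 0 + g 5 * D' 1 + g 6 * D' 0 = 0 ∧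
    g 3 * D 2 + g 4 * D 1 + g 5 * D' 2 + g 6 * D' 1 = 0 ∧ g 3 * D 3 + g 4 * D 2 + g 5 * D' 3 + g 6 * D' 2 = 0 ∧
    g 3 * D 4 + g 4 * D 3 + g 5 * D' 4 + g 6 * D' 3 = 0 ∧ g 3 * D 5 + g 4 * D 4 + g 5 * D' 5 + g 6 * D' 4 = 0 ∧
    g 4 * D 5 + g 6 * D' 5 = 0 := by
  have hu : IsUnit (Matrix.of y) := Matrix.linearIndependent_rows_iff_isUnit.1 hy
  have key : ∀ t : Fin 4 → k, ∑ i, g i • EE t D D' i = 0 := by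
    intro t
    obtain ⟨l, hl⟩ := (Matrix.mulVec_surjective_iff_isUnit.2 hu) t
    have hl' : ∀ j, eval l (vl (y j)) = t j := by
      intro j; rw [eval_vl]; exact congrFun hl j
    have := congrArg (aeval l) hg
    rw [map_sum, map_zero] at this
    rw [← this]
    refine Finset.sum_congr rfl fun i _ => ?_
    rw [map_smul]; congr 1
    fin_cases i <;> simp [EE, ZU, ZV, hl']
  have key' : ∀ a b c d : k, g 0 * (a * c - b * b) + g 1 * (a * d - b * c) + g 2 * (b * d - c * c)
      + g 3 * (D 0 * (a * a) + D 1 * (a * b) + D 2 * (a * c) + D 3 * (a * d) + D 4 * (b * d) + D 5 * (c * d))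
      + g 4 * (D 0 * (a * b) + D 1 * (a * c) + D 2 * (a * d) + D 3 * (b * d) + D 4 * (c * d) + D 5 * (d * d))
      + g 5 * (D' 0 * (a * a) + D' 1 * (a * b) + D' 2 * (a * c) + D' 3 * (a * d) + D' 4 * (b * d) + D' 5 * (c * d))
      + g 6 * (D' 0 * (a * b) + D' 1 * (a * c) + D' 2 * (a * d) + D' 3 * (b * d) + D' 4 * (c * d) + D' 5 * (d * d)) = 0 := by
    intro a b c d
    have := key ![a, b, c, d]
    rw [Fin.sum_univ_seven] at this
    exact this
  have k0 := key' 1 0 0 0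
  have k1 := key' 0 1 0 0
  have k2 := key' 0 0 1 0
  have k3 := key' 0 0 0 1
  have k01 := key' 1 1 0 0
  have k02 := key' 1 0 1 0
  have k03 := key' 1 0 0 1
  have k12 := key' 0 1 1 0
  have k13 := key' 0 1 0 1
  have k23 := key' 0 0 1 1
  have g0 : g 0 = 0 := by linear_combination -k1
  have g2 : g 2 = 0 := by linear_combination -k2
  have g1 : g 1 = 0 := by linear_combination k1 + k2 - k12
  refine ⟨g0, g1, g2, ?_, ?_, ?_, ?_, ?_, ?_, ?_⟩
  · linear_combination k0
  · linear_combination k01 - k0 - k1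
  · linear_combination k02 - k0 - k2 - g0
  · linear_combination k03 - k0 - k3 - g1
  · linear_combination k13 - k1 - k3 - g2
  · linear_combination k23 - k2 - k3
  · linear_combination k3
end partPF5

section partPF6
lemma core_no [IsAlgClosed k] {L : Submodule k (MvPolynomial (Fin 4) k)}
    (hsec : ∀ q ∈ L, q ≠ 0 → ¬ (gram q).rank ≤ 2) {e : Fin 3 → MvPolynomial (Fin 4) k}
    (heL : ∀ i, e i ∈ L) (hle : LinearIndependent k e) {y : Fin 4 → Fin 4 → k} (hy : LinearIndependent k y) {ψ : ℕ → k}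
    (hψ : ∀ i m j, y m ⬝ᵥ (gram (e i)).mulVec (y j) = ψ ((i:ℕ) + m + j)) (δ : Fin 5 → k)
    (hδ : ∀ j : Fin 5, ∑ i : Fin 5, δ i * ψ (i + j) = 0) : δ = 0 := by
  have hu : IsUnit (Matrix.of y) := Matrix.linearIndependent_rows_iff_isUnit.1 hy
  have orth : ∀ w : Fin 4 → k, (∀ m, y m ⬝ᵥ w = 0) → w = 0 := by
    intro w hw
    apply Matrix.mulVec_injective_iff_isUnit.2 hu
    rw [Matrix.mulVec_zero]
    funext m; exact hw m
  have hw : ∀ (c : Fin 4 → k) (i : Fin 3) (m : Fin 4), y m ⬝ᵥ (gram (e i)).mulVec (∑ j, c j • y j) = ∑ j : Fin 4, c j * ψ ((i:ℕ) + m + j) := by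
    intro c i m
    simp only [Matrix.mulVec_sum, Matrix.mulVec_smul, dotProduct_sum, dotProduct_smul, hψ, smul_eq_mul]
  have hc0 : ∀ c : Fin 4 → k, ∑ j, c j • y j = 0 → c = 0 := by
    intro c hc
    funext i; exact Fintype.linearIndependent_iff.1 hy c hc i
  have hle' : ∀ a b c : k, a • e 0 + b • e 1 + c • e 2 = 0 → a = 0 ∧ b = 0 ∧ c = 0 := by
    intro a b c h
    have := Fintype.linearIndependent_iff.1 hle ![a, b, c] (by rw [Fin.sum_univ_three]; exact h)
    exact ⟨this 0, this 1, this 2⟩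
  simp only [Fin.sum_univ_five] at hδ
  by_contra hne
  by_cases h4 : δ 4 = 0
  · have hwne : ∑ j, (fun j : Fin 4 => δ j.castSucc) j • y j ≠ 0 := by
      intro h
      have := hc0 _ h
      apply hne
      funext i
      rcases Fin.eq_castSucc_or_eq_last i with ⟨j, rfl⟩ | rfl
      · exact congrFun this j
      · exact h4
    refine killw hsec (heL 0) (heL 1) hwne ?_ ?_ ?_
    · apply orth
      intro m
      rw [hw, Fin.sum_univ_four, ← hδ m.castSucc, h4]
      fin_cases m <;> simp
    · apply orth
      intro m
      rw [hw, Fin.sum_univ_four, ← hδ m.succ, h4]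
      fin_cases m <;> simp
    · rw [LinearIndependent.pair_iff]
      intro s t h
      have := hle' s t 0 (by rw [zero_smul, add_zero]; exact h)
      exact ⟨this.1, this.2.1⟩
  · obtain ⟨r, hr⟩ := quart_root δ (by tauto)
    let c : Fin 4 → k := ![δ 1 + r * (δ 2 + r * (δ 3 + r * δ 4)), δ 2 + r * (δ 3 + r * δ 4), δ 3 + r * δ 4, δ 4]
    have hwne : ∑ j, c j • y j ≠ 0 := by
      intro h
      exact h4 (congrFun (hc0 _ h) 3)
    have d0 : δ 0 = - r * (δ 1 + r * (δ 2 + r * (δ 3 + r * δ 4))) := by linear_combination hr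
    refine killw hsec (L.sub_mem (heL 1) (L.smul_mem r (heL 0))) (L.sub_mem (heL 2) (L.smul_mem r (heL 1))) hwne ?_ ?_ ?_
    · apply orth
      intro m
      rw [← gramL_apply, map_sub, map_smul, gramL_apply, gramL_apply, Matrix.sub_mulVec, Matrix.smul_mulVec, dotProduct_sub,
        dotProduct_smul, hw, hw, ← hδ m.castSucc, Fin.sum_univ_four, Fin.sum_univ_four, d0]
      fin_cases m <;> simp [c] <;> ring
    · apply orth
      intro m
      rw [← gramL_apply, map_sub, map_smul, gramL_apply, gramL_apply, Matrix.sub_mulVec, Matrix.smul_mulVec, dotProduct_sub,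
        dotProduct_smul, hw, hw, ← hδ m.succ, Fin.sum_univ_four, Fin.sum_univ_four, d0]
      fin_cases m <;> simp [c] <;> ring
    · rw [LinearIndependent.pair_iff]
      intro s t h
      have := hle' (-(s * r)) (s - t * r) t (by rw [← h]; module)
      obtain ⟨_, h5, h6⟩ := this
      subst h6
      exact ⟨by simpa using h5, rfl⟩

lemma EE_li [IsAlgClosed k] {L : Submodule k (MvPolynomial (Fin 4) k)}
    (hsec : ∀ q ∈ L, q ≠ 0 → ¬ (gram q).rank ≤ 2) {e : Fin 3 → MvPolynomial (Fin 4) k}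
    (heL : ∀ i, e i ∈ L) (hle : LinearIndependent k e) {y : Fin 4 → Fin 4 → k} (hy : LinearIndependent k y) {ψ : ℕ → k}
    (hψ : ∀ i m j, y m ⬝ᵥ (gram (e i)).mulVec (y j) = ψ ((i:ℕ) + m + j)) {D D' : Fin 6 → k}
    (hDD : LinearIndependent k ![D, D'])
    (hD : ∀ j : Fin 4, ∑ i : Fin 6, D i * ψ (i + j) = 0) (hD' : ∀ j : Fin 4, ∑ i : Fin 6, D' i * ψ (i + j) = 0) :
    LinearIndependent k (EE (fun j => vl (y j)) D D') := by
  rw [Fintype.linearIndependent_iff]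
  intro g hg
  obtain ⟨g0, g1, g2, c0, c1, c2, c3, c4, c5, c6⟩ := EE_coef hy hg
  simp only [Fin.sum_univ_six] at hD hD'
  let δ : Fin 5 → k := fun i => g 4 * D i.castSucc + g 6 * D' i.castSucc
  have hδ : δ = 0 := by
    refine core_no hsec heL hle hy hψ δ ?_
    intro j
    rw [Fin.sum_univ_five]
    rcases Fin.eq_castSucc_or_eq_last j with ⟨j, rfl⟩ | rfl
    · have e1 := hD j
      have e2 := hD' j
      simp [δ] at e1 e2 ⊢
      linear_combination g 4 * e1 + g 6 * e2 - ψ (5 + j) * c6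
    · have e1 := hD 3
      have e2 := hD' 3
      simp [δ] at e1 e2 ⊢
      linear_combination - g 3 * e1 - g 5 * e2 + ψ 3 * c0 + ψ 4 * c1 + ψ 5 * c2 + ψ 6 * c3 + ψ 7 * c4 + ψ 8 * c5
  have hz := fun i => congrFun hδ i
  have z0 := hz 0
  have z1 := hz 1
  have z2 := hz 2
  have z3 := hz 3
  have z4 := hz 4
  simp [δ] at z0 z1 z2 z3 z4
  have q2 := LinearIndependent.pair_iff.1 hDD (g 4) (g 6) (by
    funext i
    fin_cases i <;> simp <;> assumption)
  have q1 := LinearIndependent.pair_iff.1 hDD (g 3) (g 5) (by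
    funext i
    fin_cases i <;> simp
    · exact c0
    · linear_combination c1 - z0
    · linear_combination c2 - z1
    · linear_combination c3 - z2
    · linear_combination c4 - z3
    · linear_combination c5 - z4)
  intro i
  fin_cases i
  · exact g0
  · exact g1
  · exact g2
  · exact q1.1
  · exact q2.1
  · exact q1.2
  · exact q2.2

lemma der_fin [IsAlgClosed k] (h2 : (2:k) ≠ 0) {L : Submodule k (MvPolynomial (Fin 4) k)}
    (hL : L ≤ homogeneousSubmodule (Fin 4) k 2) (hdim : Module.finrank k L = 3)
    (hsec : ∀ q ∈ L, q ≠ 0 → ¬ (gram q).rank ≤ 2) (hd : IsDer L) {q} (hq : IsPerpBasis L q) :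
    3 ≤ Module.finrank k (cubicRelations q) := by
  obtain ⟨e, y, hle, he, hy, hs0, hs1⟩ := hank_data h2 hdim hsec hd
  obtain ⟨ψ, hψ⟩ := hank_psi (fun i => gram (e i)) (fun i => gram_symm _) y hs0 hs1
  obtain ⟨D, D', hDD, hD, hD'⟩ := hank_ker ψ
  have heL : ∀ i, e i ∈ L := fun i => by rw [← he]; exact Submodule.subset_span ⟨i, rfl⟩
  have hE := EE_li hsec heL hle hy hψ hDD hD hD'
  have hEp := EE_perp h2 hL he hψ hD hD'
  have hEq := GG_EE (fun j => vl (y j)) D D'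
  generalize EE (fun j => vl (y j)) D D' = E at hE hEp hEq
  choose M hM using fun i => perp_rep hq (hEp i)
  have hspan : Submodule.span k (Set.range E) = Submodule.span k (Set.range q) := by
    have : FiniteDimensional k (Submodule.span k (Set.range q)) := FiniteDimensional.span_of_finite k (Set.finite_range q)
    refine Submodule.eq_of_le_of_finrank_eq ?_ ?_
    · rw [Submodule.span_le]
      rintro _ ⟨i, rfl⟩
      have := hEp i
      rw [← hq.2] at this
      exact this
    · rw [finrank_span_eq_card hE, finrank_span_eq_card hq.1]
  have hN' : ∀ j, ∃ c : Fin 7 → k, ∑ i, c i • E i = q j := by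
    intro j
    apply (Submodule.mem_span_range_iff_exists_fun k).1
    rw [hspan]; exact Submodule.subset_span ⟨j, rfl⟩
  choose N hN using hN'
  let φ : MvPolynomial (Fin 7) k →ₐ[k] MvPolynomial (Fin 7) k := aeval fun i => ∑ j, M i j • (X j : MvPolynomial (Fin 7) k)
  let χ : MvPolynomial (Fin 7) k →ₐ[k] MvPolynomial (Fin 7) k := aeval fun j => ∑ i, N j i • (X i : MvPolynomial (Fin 7) k)
  have hMN : ∀ i l, ∑ j, M i j * N j l = if i = l then 1 else 0 := by
    intro i l
    have h1 : ∑ l, (∑ j, M i j * N j l - if i = l then 1 else 0) • E l = 0 := by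
      simp only [sub_smul, Finset.sum_sub_distrib, Finset.sum_smul, ite_smul, one_smul, zero_smul, Finset.sum_ite_eq, Finset.mem_univ, if_true]
      rw [Finset.sum_comm, sub_eq_zero, ← hM i]
      refine Finset.sum_congr rfl fun j _ => ?_
      rw [← hN j, Finset.smul_sum]
      exact Finset.sum_congr rfl fun l _ => by rw [mul_smul]
    exact sub_eq_zero.1 (Fintype.linearIndependent_iff.1 hE _ h1 l)
  have hcomp : χ.comp φ = AlgHom.id k _ := by
    ext1 i
    simp only [AlgHom.comp_apply, φ, χ, aeval_X, map_sum, map_smul, AlgHom.id_apply, Finset.smul_sum, smul_smul]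
    rw [Finset.sum_comm]
    simp only [← Finset.sum_smul, hMN]
    simp
  have hinj : Function.Injective φ := by
    intro a b hab
    have := congrArg χ hab
    rwa [← AlgHom.comp_apply, ← AlgHom.comp_apply, hcomp] at this
  have hqE : (aeval q).comp φ = (aeval E : MvPolynomial (Fin 7) k →ₐ[k] _) := by
    ext1 i
    simp only [AlgHom.comp_apply, φ, aeval_X, map_sum, map_smul, hM]
  have hmem : ∀ i, φ (GG D D' i) ∈ cubicRelations q := by
    intro i
    refine ⟨?_, ?_⟩
    · have := (GG_homog D D' i : (GG D D' i).IsHomogeneous 3)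
      have h1 := this.aeval (fun i => ∑ j, M i j • (X j : MvPolynomial (Fin 7) k)) (n := 1) (by
        intro i
        refine IsHomogeneous.sum _ _ _ fun j _ => ?_
        rw [smul_eq_C_mul]
        exact (isHomogeneous_X k j).C_mul _)
      rw [one_mul] at h1; exact h1
    · change aeval q (φ (GG D D' i)) = 0
      rw [← AlgHom.comp_apply, hqE]; exact hEq i
  have hli : LinearIndependent k (fun i => φ (GG D D' i)) :=
    (GG_li h2 D D').map' φ.toLinearMap (LinearMap.ker_eq_bot.2 hinj)
  have hli' : LinearIndependent k (fun i => (⟨φ (GG D D' i), hmem i⟩ : cubicRelations q)) :=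
    LinearIndependent.of_comp (cubicRelations q).subtype hli
  have : FiniteDimensional k (homogeneousSubmodule (Fin 7) k 3) := by
    apply Module.finite_of_finrank_pos
    rw [finrank_homog]; decide
  have : FiniteDimensional k (cubicRelations q) := Submodule.finiteDimensional_of_le (inf_le_left : cubicRelations q ≤ homogeneousSubmodule (Fin 7) k 3)
  simpa using hli'.fintype_card_le_finrank
end partPF6

/-- For a 3-dimensional space `L` of quadratic forms in
`k[x₀,x₁,x₂,x₃]` containing no nonzero form of rank `≤ 2`, the following are
equivalent: (i) some nonzero cubic vanishes on the projected Veronese `X_L`;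
(ii) `X_L` lies on an at least 3-dimensional space of cubics;
(iii) `L` is spanned by three partial derivatives of a cubic form. -/
theorem projected_veronese_cubics_tfae
    [IsAlgClosed k] (h2 : (2 : k) ≠ 0) (h3 : (3 : k) ≠ 0)
    (L : Submodule k (MvPolynomial (Fin 4) k))
    (hquad : L ≤ homogeneousSubmodule (Fin 4) k 2)
    (hdim : Module.finrank k L = 3)
    (hsec : ∀ q ∈ L, q ≠ 0 → ¬ (gram q).rank ≤ 2) :
    ((∀ q : Fin 7 → MvPolynomial (Fin 4) k, IsPerpBasis L q → cubicRelations q ≠ ⊥) ↔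
      (∀ q : Fin 7 → MvPolynomial (Fin 4) k, IsPerpBasis L q →
        3 ≤ Module.finrank k (cubicRelations q))) ∧
    ((∀ q : Fin 7 → MvPolynomial (Fin 4) k, IsPerpBasis L q → cubicRelations q ≠ ⊥) ↔
      (∃ (F : MvPolynomial (Fin 4) k) (v₁ v₂ v₃ : Fin 4 → k), F.IsHomogeneous 3 ∧
        L = Submodule.span k {dirDeriv v₁ F, dirDeriv v₂ F, dirDeriv v₃ F})) := by
  have A : (∀ q : Fin 7 → MvPolynomial (Fin 4) k, IsPerpBasis L q → cubicRelations q ≠ ⊥) → IsDer L := by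
    intro h
    by_contra hno
    obtain ⟨q, hq⟩ := exists_perpBasis h2 hquad hdim
    exact h q hq (cubicRel_bot h2 h3 hquad hdim hsec hno hq)
  have B : IsDer L → ∀ q : Fin 7 → MvPolynomial (Fin 4) k, IsPerpBasis L q →
      3 ≤ Module.finrank k (cubicRelations q) := fun hd q hq => der_fin h2 hquad hdim hsec hd hq
  have D : (∀ q : Fin 7 → MvPolynomial (Fin 4) k, IsPerpBasis L q → 3 ≤ Module.finrank k (cubicRelations q)) →
      ∀ q : Fin 7 → MvPolynomial (Fin 4) k, IsPerpBasis L q → cubicRelations q ≠ ⊥ := by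
    intro h q hq h0
    have := h q hq
    rw [h0, finrank_bot] at this
    omega
  exact ⟨⟨fun h => B (A h), D⟩, ⟨A, fun h => D (B h)⟩⟩

end
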